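/- arXiv:2208.10521 — 3 statements merged into one kernel-verified Lean document; each statement's English description precedes it below -/
import Mathlib

section
/- Suppose the inlier set I satisfies |I| = αn ≥ (n + d̄)/2 for a positive integer d̄, and that every subset of I of cardinality d̄ is nondegenerate. Let d_J be any integer with d̄ ≤ d_J ≤ (2α−1)·n. Then every MC-optimal pair (x_MC, ω_MC), with selected set I_MC := {i ∈ {1,…,n} : ω_MC,i = 1}, satisfies ( min over all J ⊆ I_MC with |J| = d_J of σ_min(A_J) ) · ‖x_MC − x°‖ ≤ 2·√(d_J)·c̄ (equivalently, ‖x_MC − x°‖ ≤ 2·√(d_J)·c̄ / min_{J ⊆ I_MC, |J| = d_J} σ_min(A_J) whenever this minimum is positive). -/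
open scoped BigOperators

noncomputable section

/-- Euclidean norm of a finite real vector. -/
def enorm {d : ℕ} (v : Fin d → ℝ) : ℝ := Real.sqrt (∑ k, v k ^ 2)

/-- Residual `‖y_i − A_iᵀ x‖` of `x` at measurement `i`. -/
def resid {n dx dy : ℕ} (y : Fin n → Fin dy → ℝ)
    (A : Fin n → Matrix (Fin dx) (Fin dy) ℝ) (x : Fin dx → ℝ) (i : Fin n) : ℝ :=
  enorm fun j => y i j - ∑ k, A i k j * x k

/-- Feasibility for the (MC) problem. -/
def MCFeasible {n dx dy : ℕ} (y : Fin n → Fin dy → ℝ)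
    (A : Fin n → Matrix (Fin dx) (Fin dy) ℝ) (𝕏 : Set (Fin dx → ℝ)) (cbar : ℝ)
    (ω : Fin n → ℝ) (x : Fin dx → ℝ) : Prop :=
  (∀ i, ω i = 0 ∨ ω i = 1) ∧ x ∈ 𝕏 ∧ ∀ i, ω i * resid y A x i ^ 2 ≤ cbar ^ 2

/-- `(x, ω)` is an optimal solution of (MC). -/
def MCOptimal {n dx dy : ℕ} (y : Fin n → Fin dy → ℝ)
    (A : Fin n → Matrix (Fin dx) (Fin dy) ℝ) (𝕏 : Set (Fin dx → ℝ)) (cbar : ℝ)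
    (ω : Fin n → ℝ) (x : Fin dx → ℝ) : Prop :=
  MCFeasible y A 𝕏 cbar ω x ∧
    ∀ ω' x', MCFeasible y A 𝕏 cbar ω' x' → ∑ i, ω' i ≤ ∑ i, ω i

/-- The (TLS) objective. -/
def tlsObj {n dx dy : ℕ} (y : Fin n → Fin dy → ℝ)
    (A : Fin n → Matrix (Fin dx) (Fin dy) ℝ) (cbar : ℝ) (x : Fin dx → ℝ) : ℝ :=
  ∑ i, min (resid y A x i ^ 2) (cbar ^ 2)

/-- `x` is an optimal solution of (TLS). -/
def TLSOptimal {n dx dy : ℕ} (y : Fin n → Fin dy → ℝ)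
    (A : Fin n → Matrix (Fin dx) (Fin dy) ℝ) (𝕏 : Set (Fin dx → ℝ)) (cbar : ℝ)
    (x : Fin dx → ℝ) : Prop :=
  x ∈ 𝕏 ∧ ∀ x' ∈ 𝕏, tlsObj y A cbar x ≤ tlsObj y A cbar x'

/-- A set `J` of measurement indices is nondegenerate: the least-squares problem
over `J` admits a unique minimizer on `𝕏`. -/
def Nondegenerate {n dx dy : ℕ} (y : Fin n → Fin dy → ℝ)
    (A : Fin n → Matrix (Fin dx) (Fin dy) ℝ) (𝕏 : Set (Fin dx → ℝ))
    (J : Finset (Fin n)) : Prop :=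
  ∃! x, x ∈ 𝕏 ∧ ∀ x' ∈ 𝕏, ∑ i ∈ J, resid y A x i ^ 2 ≤ ∑ i ∈ J, resid y A x' i ^ 2

/-- Smallest singular value of the matrix stacking the blocks `A_iᵀ`, `i ∈ J`. -/
def sigmaMin {n dx dy : ℕ} (A : Fin n → Matrix (Fin dx) (Fin dy) ℝ)
    (J : Finset (Fin n)) : ℝ :=
  sInf { s | ∃ v : Fin dx → ℝ, _root_.enorm v = 1 ∧
    s = Real.sqrt (∑ i ∈ J, ∑ j, (∑ k, A i k j * v k) ^ 2) }

lemma sq_enorm {d : ℕ} (v : Fin d → ℝ) : _root_.enorm v ^ 2 = ∑ k, v k ^ 2 :=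
  Real.sq_sqrt (Finset.sum_nonneg fun _ _ => sq_nonneg _)

lemma sigmaMin_nonneg {n dx dy : ℕ} (A : Fin n → Matrix (Fin dx) (Fin dy) ℝ)
    (J : Finset (Fin n)) : 0 ≤ sigmaMin A J := by
  apply Real.sInf_nonneg
  rintro s ⟨v, -, rfl⟩
  exact Real.sqrt_nonneg _

/-- The smallest singular value bounds the stacked matrix from below. -/
lemma sigmaMin_mul_enorm_le {n dx dy : ℕ} (A : Fin n → Matrix (Fin dx) (Fin dy) ℝ)
    (J : Finset (Fin n)) (v : Fin dx → ℝ) :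
    sigmaMin A J * _root_.enorm v ≤
      Real.sqrt (∑ i ∈ J, ∑ j, (∑ k, A i k j * v k) ^ 2) := by
  rcases (Real.sqrt_nonneg (∑ k, v k ^ 2)).eq_or_lt with h | h
  · rw [show _root_.enorm v = 0 from h.symm, mul_zero]
    exact Real.sqrt_nonneg _
  change 0 < _root_.enorm v at h
  have hunit : _root_.enorm (fun k => v k / _root_.enorm v) = 1 := by
    rw [_root_.enorm, Real.sqrt_eq_one]
    simp_rw [div_pow]
    rw [← Finset.sum_div, ← sq_enorm, div_self (by positivity)]
  have hscale : ∑ i ∈ J, ∑ j, (∑ k, A i k j * (v k / _root_.enorm v)) ^ 2 =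
      (∑ i ∈ J, ∑ j, (∑ k, A i k j * v k) ^ 2) / _root_.enorm v ^ 2 := by
    simp_rw [← mul_div_assoc, ← Finset.sum_div, div_pow, ← Finset.sum_div]
  have hle : sigmaMin A J ≤
      Real.sqrt (∑ i ∈ J, ∑ j, (∑ k, A i k j * (v k / _root_.enorm v)) ^ 2) := by
    refine csInf_le ⟨0, ?_⟩ ⟨_, hunit, rfl⟩
    rintro s ⟨w, -, rfl⟩
    exact Real.sqrt_nonneg _
  rwa [hscale, Real.sqrt_div' _ (sq_nonneg _), Real.sqrt_sq h.le, le_div_iff₀ h] at hle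

/-- Two points whose residuals at a measurement are at most `c` have images at distance at
most `2 * c`. -/
lemma sum_sq_sub_le_of_resid_le {n dx dy : ℕ} {y : Fin n → Fin dy → ℝ}
    {A : Fin n → Matrix (Fin dx) (Fin dy) ℝ} {x x' : Fin dx → ℝ} {i : Fin n} {c : ℝ}
    (hx : resid y A x i ^ 2 ≤ c ^ 2) (hx' : resid y A x' i ^ 2 ≤ c ^ 2) :
    ∑ j, (∑ k, A i k j * (x - x') k) ^ 2 ≤ 4 * c ^ 2 := by
  rw [resid, sq_enorm] at hx hx'
  calc ∑ j, (∑ k, A i k j * (x - x') k) ^ 2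
      ≤ ∑ j, (2 * (y i j - ∑ k, A i k j * x k) ^ 2 +
          2 * (y i j - ∑ k, A i k j * x' k) ^ 2) := by
        refine Finset.sum_le_sum fun j _ => ?_
        simp only [Pi.sub_apply, mul_sub, Finset.sum_sub_distrib]
        nlinarith [sq_nonneg ((y i j - ∑ k, A i k j * x k) + (y i j - ∑ k, A i k j * x' k))]
    _ ≤ 4 * c ^ 2 := by
        rw [Finset.sum_add_distrib, ← Finset.mul_sum, ← Finset.mul_sum]
        linarith

open Classical in
/-- An optimal selection has at least as many elements as any set of inliers. -/
lemma MCOptimal.card_le {n dx dy : ℕ} {y : Fin n → Fin dy → ℝ}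
    {A : Fin n → Matrix (Fin dx) (Fin dy) ℝ} {𝕏 : Set (Fin dx → ℝ)} {c : ℝ}
    {ω : Fin n → ℝ} {x x0 : Fin dx → ℝ} (h : MCOptimal y A 𝕏 c ω x) (hx0 : x0 ∈ 𝕏)
    {I : Finset (Fin n)} (hI : ∀ i ∈ I, resid y A x0 i ^ 2 ≤ c ^ 2) :
    I.card ≤ (Finset.univ.filter fun i => ω i = 1).card := by
  have hle := h.2 (fun i => if i ∈ I then 1 else 0) x0
    ⟨fun i => by by_cases hi : i ∈ I <;> simp [hi], hx0,
    fun i => by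
      by_cases hi : i ∈ I
      · simpa [hi] using hI i hi
      · simpa [hi] using sq_nonneg c⟩
  have hω : ∑ i, ω i = ∑ i, if ω i = 1 then (1 : ℝ) else 0 :=
    Finset.sum_congr rfl fun i _ => by rcases h.1.1 i with hi | hi <;> simp [hi]
  rw [hω, Finset.sum_boole, Finset.sum_boole] at hle
  simpa using hle

/-- A posteriori estimation contract for (MC) (Proposition 1, noisy bound). -/
theorem mc_a_posteriori_contract
    {n dx dy : ℕ} (hn : 0 < n) (hdx : 0 < dx) (hdy : 0 < dy)
    (y : Fin n → Fin dy → ℝ) (A : Fin n → Matrix (Fin dx) (Fin dy) ℝ)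
    (𝕏 : Set (Fin dx → ℝ)) (x0 : Fin dx → ℝ) (hx0 : x0 ∈ 𝕏)
    (cbar : ℝ) (hcbar : 0 ≤ cbar)
    (α : ℝ) (hα0 : 0 < α) (hα1 : α ≤ 1)
    (I : Finset (Fin n)) (hIcard : (I.card : ℝ) = α * n)
    (hinlier : ∀ i ∈ I, resid y A x0 i ≤ cbar)
    (dbar : ℕ) (hdbar : 0 < dbar)
    (hsize : ((n : ℝ) + dbar) / 2 ≤ α * n)
    (hnondeg : ∀ J ⊆ I, J.card = dbar → Nondegenerate y A 𝕏 J)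
    (dJ : ℕ) (hdJlo : dbar ≤ dJ) (hdJhi : (dJ : ℝ) ≤ (2 * α - 1) * n)
    (xMC : Fin dx → ℝ) (ωMC : Fin n → ℝ) (hopt : MCOptimal y A 𝕏 cbar ωMC xMC) :
    sInf { s | ∃ J : Finset (Fin n),
        (∀ i ∈ J, ωMC i = 1) ∧ J.card = dJ ∧ s = sigmaMin A J } *
      _root_.enorm (xMC - x0) ≤ 2 * Real.sqrt dJ * cbar := by
  classical
  have hsq : ∀ i ∈ I, resid y A x0 i ^ 2 ≤ cbar ^ 2 := fun i hi =>
    pow_le_pow_left₀ (Real.sqrt_nonneg _) (hinlier i hi) 2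
  set S := Finset.univ.filter fun i => ωMC i = 1 with hS
  have hIS : I.card ≤ S.card := hopt.card_le hx0 hsq
  have hcard : dJ ≤ (I ∩ S).card := by
    have hunion := Finset.card_union_add_card_inter I S
    have hn' : (I ∪ S).card ≤ n := by simpa using Finset.card_le_univ (I ∪ S)
    have hd : dJ + n ≤ 2 * I.card := by
      have : (dJ : ℝ) + n ≤ 2 * I.card := by rw [hIcard]; linarith
      exact_mod_cast this
    omega
  obtain ⟨J, hJ, hJcard⟩ := Finset.exists_subset_card_eq hcard
  have hJω : ∀ i ∈ J, ωMC i = 1 := fun i hi => by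
    simpa [hS] using Finset.inter_subset_right (hJ hi)
  have hterm : ∀ i ∈ J, ∑ j, (∑ k, A i k j * (xMC - x0) k) ^ 2 ≤ 4 * cbar ^ 2 := fun i hi =>
    sum_sq_sub_le_of_resid_le (by simpa [hJω i hi] using hopt.1.2.2 i)
      (hsq i (Finset.inter_subset_left (hJ hi)))
  have hinf : sInf { s | ∃ J : Finset (Fin n),
      (∀ i ∈ J, ωMC i = 1) ∧ J.card = dJ ∧ s = sigmaMin A J } ≤ sigmaMin A J := by
    refine csInf_le ⟨0, ?_⟩ ⟨J, hJω, hJcard, rfl⟩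
    rintro s ⟨K, -, -, rfl⟩
    exact sigmaMin_nonneg A K
  calc _ ≤ sigmaMin A J * _root_.enorm (xMC - x0) :=
        mul_le_mul_of_nonneg_right hinf (Real.sqrt_nonneg _)
    _ ≤ Real.sqrt (∑ i ∈ J, ∑ j, (∑ k, A i k j * (xMC - x0) k) ^ 2) :=
        sigmaMin_mul_enorm_le A J _
    _ ≤ 2 * Real.sqrt dJ * cbar := by
        refine Real.sqrt_le_iff.2 ⟨by positivity, (Finset.sum_le_card_nsmul J _ _ hterm).trans ?_⟩
        rw [hJcard, nsmul_eq_mul, mul_pow, mul_pow, Real.sq_sqrt (Nat.cast_nonneg _)]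
        linarith
end
end

section
/- Suppose c̄ = 0, the inliers are noiseless (y_i = A_iᵀ x° for every i ∈ I), |I| = αn ≥ (n + d̄)/2 for a positive integer d̄, and every subset of I of cardinality d̄ is nondegenerate. Then every MC-optimal pair (x_MC, ω_MC) satisfies x_MC = x°. -/
open scoped BigOperators

noncomputable section

/-- A point of `𝕏` with zero residual at every index of `J` solves the least-squares problem
over `J`. -/
theorem sum_resid_sq_le_of_resid_eq_zero {n dx dy : ℕ} {y : Fin n → Fin dy → ℝ}
    {A : Fin n → Matrix (Fin dx) (Fin dy) ℝ} {J : Finset (Fin n)} {x : Fin dx → ℝ}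
    (hx : ∀ i ∈ J, resid y A x i = 0) (x' : Fin dx → ℝ) :
    ∑ i ∈ J, resid y A x i ^ 2 ≤ ∑ i ∈ J, resid y A x' i ^ 2 :=
  Finset.sum_le_sum fun i hi => by
    rw [hx i hi, zero_pow two_ne_zero]
    exact sq_nonneg _

/-- If all inliers are noiseless, an (MC)-optimal selection for `c̄ = 0` keeps at least as many
measurements as there are inliers. -/
theorem card_le_card_filter_of_mcOptimal {n dx dy : ℕ} {y : Fin n → Fin dy → ℝ}
    {A : Fin n → Matrix (Fin dx) (Fin dy) ℝ} {𝕏 : Set (Fin dx → ℝ)} {x0 xMC : Fin dx → ℝ}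
    {ω : Fin n → ℝ} {I : Finset (Fin n)} (hx0 : x0 ∈ 𝕏) (hI : ∀ i ∈ I, resid y A x0 i = 0)
    (hopt : MCOptimal y A 𝕏 0 ω xMC) :
    I.card ≤ (Finset.univ.filter fun i => ω i = 1).card := by
  have hfeas : MCFeasible y A 𝕏 0 (fun i => if i ∈ I then 1 else 0) x0 := by
    refine ⟨fun i => ?_, hx0, fun i => ?_⟩ <;> by_cases hi : i ∈ I <;> simp [hi, hI]
  have hsum := hopt.2 _ _ hfeas
  have hω : ∑ i, ω i = ((Finset.univ.filter fun i => ω i = 1).card : ℝ) := by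
    rw [Finset.card_filter, Nat.cast_sum]
    refine Finset.sum_congr rfl fun i _ => ?_
    rcases hopt.1.1 i with h | h <;> simp [h]
  rw [hω] at hsum
  simpa using hsum

/-- A posteriori estimation contract for (MC), noiseless case: with `c̄ = 0`,
noiseless inliers, at least `(n + d̄)/2` inliers and nondegeneracy of every
`d̄`-subset of inliers, every MC-optimal pair recovers the ground truth. -/
theorem mc_a_posteriori_contract_noiseless
    {n dx dy : ℕ} (hn : 0 < n) (hdx : 0 < dx) (hdy : 0 < dy)
    (y : Fin n → Fin dy → ℝ) (A : Fin n → Matrix (Fin dx) (Fin dy) ℝ)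
    (𝕏 : Set (Fin dx → ℝ)) (x0 : Fin dx → ℝ) (hx0 : x0 ∈ 𝕏)
    (α : ℝ) (hα0 : 0 < α) (hα1 : α ≤ 1)
    (I : Finset (Fin n)) (hIcard : (I.card : ℝ) = α * n)
    (hnoiseless : ∀ i ∈ I, ∀ j, y i j = ∑ k, A i k j * x0 k)
    (dbar : ℕ) (hdbar : 0 < dbar)
    (hsize : ((n : ℝ) + dbar) / 2 ≤ α * n)
    (hnondeg : ∀ J ⊆ I, J.card = dbar → Nondegenerate y A 𝕏 J)
    (xMC : Fin dx → ℝ) (ωMC : Fin n → ℝ)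
    (hopt : MCOptimal y A 𝕏 (0 : ℝ) ωMC xMC) :
    xMC = x0 := by
  have hI : ∀ i ∈ I, resid y A x0 i = 0 := fun i hi => by
    simp [resid, _root_.enorm, hnoiseless i hi]
  set S : Finset (Fin n) := Finset.univ.filter fun i => ωMC i = 1
  have hS0 : ∀ i ∈ S, resid y A xMC i = 0 := fun i hi => by
    have h := hopt.1.2.2 i
    rw [(Finset.mem_filter.mp hi).2, one_mul, zero_pow two_ne_zero] at h
    exact pow_eq_zero_iff two_ne_zero |>.mp (le_antisymm h (sq_nonneg _))
  have hIS : I.card ≤ S.card := card_le_card_filter_of_mcOptimal hx0 hI hopt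
  have hsize' : n + dbar ≤ 2 * I.card := by
    have h : (n : ℝ) + dbar ≤ 2 * I.card := by linarith
    exact_mod_cast h
  have hinter : dbar ≤ (I ∩ S).card := by
    have h := Finset.card_union_add_card_inter I S
    have hle : (I ∪ S).card ≤ n := by simpa using Finset.card_le_univ (I ∪ S)
    omega
  obtain ⟨J, hJ, hJcard⟩ := Finset.exists_subset_card_eq hinter
  have hJI : J ⊆ I := hJ.trans Finset.inter_subset_left
  have hJS : J ⊆ S := hJ.trans Finset.inter_subset_right
  exact (hnondeg J hJI hJcard).unique
    ⟨hopt.1.2.1, fun x' _ => sum_resid_sq_le_of_resid_eq_zero (fun i hi => hS0 i (hJS hi)) x'⟩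
    ⟨hx0, fun x' _ => sum_resid_sq_le_of_resid_eq_zero (fun i hi => hI i (hJI hi)) x'⟩
end
end

section
/- Assume the anti-concentration hypothesis: c̄ > 0, η > 0, k is a positive even integer, and the inlier matrices {A_i}_{i∈I} are k-certifiably (α²·η²·(1−2c̄)²/(32·c̄), 2c̄, 2M_x)-anti-concentrated. Then every pseudo-distribution μ̃ of level 2r, for an integer r ≥ k/2, in the variables (ω, x) that satisfies T_{ω,x} at degree 0 yields an estimate x̂ with ‖x̂ − x°‖ ≤ α·η·M_x/2 + 2·M_x·(1−α)/α. -/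
open scoped BigOperators
open MvPolynomial

noncomputable section

/-- A polynomial is a sum of squares. -/
def IsSOS {V : Type*} (p : MvPolynomial V ℝ) : Prop :=
  ∃ (N : ℕ) (q : Fin N → MvPolynomial V ℝ), p = ∑ j, q j ^ 2

/-- A degree-`k` sum-of-squares proof that the system `{A i ≥ 0}` implies `g ≥ 0`:
a family of sos polynomials `P S`, indexed by the subsets `S` of the constraint
indices, with `g = ∑_S P S · ∏_{i∈S} A i` and every summand of degree at most `k`. -/
def SosProof {V ι : Type*} [Fintype ι] [DecidableEq ι]
    (A : ι → MvPolynomial V ℝ) (k : ℕ) (g : MvPolynomial V ℝ) : Prop :=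
  ∃ P : Finset ι → MvPolynomial V ℝ,
    (∀ S, IsSOS (P S)) ∧
    g = ∑ S : Finset ι, P S * ∏ i ∈ S, A i ∧
    ∀ S : Finset ι, (P S * ∏ i ∈ S, A i).totalDegree ≤ k

/-- Pseudo-expectation of `f` under the finitely supported `μ`. -/
def pExpect {V : Type*} (μ : (V → ℝ) →₀ ℝ) (f : (V → ℝ) → ℝ) : ℝ :=
  ∑ z ∈ μ.support, μ z * f z

/-- `μ` is a pseudo-distribution of level `ℓ`: finitely supported, total mass one,
and nonnegative pseudo-expectation on every square of a polynomial of degree `≤ ℓ/2`. -/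
def IsPseudoDist {V : Type*} (μ : (V → ℝ) →₀ ℝ) (ℓ : ℕ) : Prop :=
  (∑ z ∈ μ.support, μ z) = 1 ∧
  ∀ p : MvPolynomial V ℝ, p.totalDegree ≤ ℓ / 2 →
    0 ≤ pExpect μ fun z => MvPolynomial.eval z p ^ 2

/-- A level-`ℓ` pseudo-distribution `μ` satisfies the system `{A i ≥ 0}` at degree `k`. -/
def PDSatisfies {V ι : Type*} [Fintype ι] [DecidableEq ι]
    (μ : (V → ℝ) →₀ ℝ) (ℓ : ℕ) (A : ι → MvPolynomial V ℝ) (k : ℕ) : Prop :=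
  ∀ (S : Finset ι) (h : MvPolynomial V ℝ), IsSOS h →
    h.totalDegree + ∑ i ∈ S, max (A i).totalDegree k ≤ ℓ →
    0 ≤ pExpect μ fun z => MvPolynomial.eval z (h * ∏ i ∈ S, A i)

/-- The polynomial `‖A_iᵀ v‖²` in the indeterminate `v ∈ ℝ^{dx}`. -/
def normAPoly {n dx dy : ℕ} (A : Fin n → Matrix (Fin dx) (Fin dy) ℝ) (i : Fin n) :
    MvPolynomial (Fin dx) ℝ :=
  ∑ j, (∑ k, C (A i k j) * X k) ^ 2

/-- The polynomial `‖v‖²` in the indeterminate `v ∈ ℝ^{dx}`. -/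
def vnormPoly (dx : ℕ) : MvPolynomial (Fin dx) ℝ :=
  ∑ k, (X k : MvPolynomial (Fin dx) ℝ) ^ 2

/-- The matrices `{A_i}_{i∈I}` are `k`-certifiably `(Cc, δ, M)`-anti-concentrated:
there is an even univariate polynomial `p` with `p 0 = 1` (evenness witnessed by
`q` with `p(t) = q(t²)`) such that the two anti-concentration inequalities admit
degree-`k` sum-of-squares proofs; `p(‖A_iᵀ v‖)² = q(‖A_iᵀ v‖²)²` as a polynomial in `v`. -/
def AntiConcentrated {n dx dy : ℕ} (A : Fin n → Matrix (Fin dx) (Fin dy) ℝ)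
    (I : Finset (Fin n)) (k : ℕ) (Cc δ M : ℝ) : Prop :=
  ∃ p q : Polynomial ℝ,
    (∀ t : ℝ, p.eval t = q.eval (t ^ 2)) ∧ p.eval 0 = 1 ∧
    (∀ i ∈ I,
      SosProof (fun _ : Fin 1 => C (δ ^ 2) - normAPoly A i) k
        (Polynomial.aeval (normAPoly A i) q ^ 2 - C ((1 - δ) ^ 2))) ∧
    SosProof (fun _ : Fin 1 => C (M ^ 2) - vnormPoly dx) k
      (C (Cc * δ * M ^ 2) -
        vnormPoly dx *
          (C ((I.card : ℝ)⁻¹) * ∑ i ∈ I, Polynomial.aeval (normAPoly A i) q ^ 2))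

/-- The polynomial `‖y_i − A_iᵀ x‖²` in the variables `(ω, x)`. -/
def residPoly {n dx dy : ℕ} (y : Fin n → Fin dy → ℝ)
    (A : Fin n → Matrix (Fin dx) (Fin dy) ℝ) (i : Fin n) :
    MvPolynomial (Fin n ⊕ Fin dx) ℝ :=
  ∑ j, (C (y i j) - ∑ k, C (A i k j) * X (Sum.inr k)) ^ 2

/-- The system `M_{ω,x}`: `ω_i² = ω_i` (two inequalities each),
`c̄² − ω_i·‖y_i − A_iᵀ x‖² ≥ 0`, and the inequalities `g_j(x) ≥ 0` describing `𝕏`. -/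
def sysM {n dx dy mX : ℕ} (y : Fin n → Fin dy → ℝ)
    (A : Fin n → Matrix (Fin dx) (Fin dy) ℝ)
    (g : Fin mX → MvPolynomial (Fin dx) ℝ) (cbar : ℝ) :
    Fin n ⊕ Fin n ⊕ Fin n ⊕ Fin mX → MvPolynomial (Fin n ⊕ Fin dx) ℝ
  | Sum.inl i => X (Sum.inl i) - X (Sum.inl i) ^ 2
  | Sum.inr (Sum.inl i) => X (Sum.inl i) ^ 2 - X (Sum.inl i)
  | Sum.inr (Sum.inr (Sum.inl i)) => C (cbar ^ 2) - X (Sum.inl i) * residPoly y A i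
  | Sum.inr (Sum.inr (Sum.inr j)) => rename Sum.inr (g j)

/-- The system `T_{ω,x}`: `M_{ω,x}` together with `∑ ω_i = αn` (two inequalities). -/
def sysT {n dx dy mX : ℕ} (y : Fin n → Fin dy → ℝ)
    (A : Fin n → Matrix (Fin dx) (Fin dy) ℝ)
    (g : Fin mX → MvPolynomial (Fin dx) ℝ) (cbar α : ℝ) :
    Fin 2 ⊕ (Fin n ⊕ Fin n ⊕ Fin n ⊕ Fin mX) → MvPolynomial (Fin n ⊕ Fin dx) ℝ
  | Sum.inl j =>
      if j = 0 then C (α * n) - ∑ i, X (Sum.inl i)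
      else (∑ i, (X (Sum.inl i) : MvPolynomial (Fin n ⊕ Fin dx) ℝ)) - C (α * n)
  | Sum.inr e => sysM y A g cbar e

/-- The pseudo-expectation `Ẽ_μ[ω_i]`. -/
def Eω {n dx : ℕ} (μ : (Fin n ⊕ Fin dx → ℝ) →₀ ℝ) (i : Fin n) : ℝ :=
  pExpect μ fun z => z (Sum.inl i)

/-- The vector `v_i := Ẽ_μ[ω_i·x] / Ẽ_μ[ω_i]` if `Ẽ_μ[ω_i] > 0`, else `0`. -/
def vEst {n dx : ℕ} (μ : (Fin n ⊕ Fin dx → ℝ) →₀ ℝ) (i : Fin n) : Fin dx → ℝ :=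
  if 0 < Eω μ i then
    fun k => (Eω μ i)⁻¹ * pExpect μ fun z => z (Sum.inl i) * z (Sum.inr k)
  else 0

/-- The estimate `x̂ := ∑_i (Ẽ_μ[ω_i] / ∑_j Ẽ_μ[ω_j]) · v_i`. -/
def xhat {n dx : ℕ} (μ : (Fin n ⊕ Fin dx → ℝ) →₀ ℝ) : Fin dx → ℝ :=
  fun k => ∑ i, Eω μ i / (∑ j, Eω μ j) * vEst μ i k

theorem Polynomial.eval_nonneg_of_punctured {a b c : ℝ} (hab : a < b) (hc : c ∈ Set.Icc a b)
    (f : Polynomial ℝ) (hf : ∀ u ∈ Set.Icc a b, u ≠ c → 0 ≤ f.eval u) : 0 ≤ f.eval c := by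
  have hacc : AccPt c (Filter.principal (Set.Icc a b)) :=
    isPreconnected_Icc.preperfect_of_nontrivial
      ⟨a, Set.left_mem_Icc.2 hab.le, b, Set.right_mem_Icc.2 hab.le, hab.ne⟩ c hc
  have : (nhdsWithin c {c}ᶜ ⊓ Filter.principal (Set.Icc a b)).NeBot := hacc
  refine ge_of_tendsto
    (f.continuous.continuousAt.tendsto.mono_left (inf_le_left.trans inf_le_left) :
      Filter.Tendsto _ (nhdsWithin c {c}ᶜ ⊓ Filter.principal (Set.Icc a b)) _) ?_
  rw [Filter.eventually_inf_principal]
  filter_upwards [self_mem_nhdsWithin] with u hu hu'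
  exact hf u hu' hu

/-- Dual form of the Markov–Lukács theorem: a linear functional which is nonnegative on the
generators `s²`, `X s²`, `(ℓ - X) s²`, `X (ℓ - X) s²` of degree at most `N` is nonnegative on every
polynomial of degree at most `N` that is nonnegative on `[0, ℓ]`. -/
theorem Polynomial.linearMap_nonneg_of_nonneg_on_Icc {ℓ : ℝ} (hℓ : 0 < ℓ) (N : ℕ) :
    ∀ Λ : Polynomial ℝ →ₗ[ℝ] ℝ,
      (∀ s : Polynomial ℝ, 2 * s.natDegree ≤ N → 0 ≤ Λ (s ^ 2)) →
      (∀ s : Polynomial ℝ, 2 * s.natDegree + 1 ≤ N → 0 ≤ Λ (X * s ^ 2)) →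
      (∀ s : Polynomial ℝ, 2 * s.natDegree + 1 ≤ N → 0 ≤ Λ ((C ℓ - X) * s ^ 2)) →
      (∀ s : Polynomial ℝ, 2 * s.natDegree + 2 ≤ N → 0 ≤ Λ (X * (C ℓ - X) * s ^ 2)) →
      ∀ f : Polynomial ℝ, f.natDegree ≤ N → (∀ u ∈ Set.Icc 0 ℓ, 0 ≤ f.eval u) → 0 ≤ Λ f := by
  induction N using Nat.strong_induction_on with
  | _ N ih =>
  intro Λ h0 h1 h2 h3 f hfN hf
  have hconst : ∀ c : ℝ, 0 ≤ c → 0 ≤ Λ (C c) := by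
    intro c hc
    have : (C c : Polynomial ℝ) = c • (1 : Polynomial ℝ) ^ 2 := by
      simp [Polynomial.smul_eq_C_mul]
    rw [this, map_smul, smul_eq_mul]
    exact mul_nonneg hc (h0 1 (by simp))
  obtain ⟨c, hc, hmin⟩ := isCompact_Icc.exists_isMinOn (Set.nonempty_Icc.2 hℓ.le)
    (f.continuous.continuousOn (s := Set.Icc 0 ℓ))
  have hmin' : ∀ u ∈ Set.Icc 0 ℓ, f.eval c ≤ f.eval u := fun u hu => hmin hu
  obtain ⟨g, hg⟩ : (X - C c) ∣ f - C (f.eval c) := by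
    rw [Polynomial.dvd_iff_isRoot]; simp
  have hge : ∀ u, f.eval u - f.eval c = (u - c) * g.eval u := by
    intro u; simpa using congrArg (Polynomial.eval u) hg
  have hfg : Λ f = Λ (C (f.eval c)) + Λ ((X - C c) * g) := by
    rw [← map_add, ← hg]; congr 1; ring
  rw [hfg]
  refine add_nonneg (hconst _ (hf c hc)) ?_
  have hdiv : ∀ (a : ℝ) (p : Polynomial ℝ), p ≠ 0 →
      ((X - C a) * p).natDegree = p.natDegree + 1 := by
    intro a p hp
    rw [Polynomial.natDegree_mul (Polynomial.X_sub_C_ne_zero a) hp, Polynomial.natDegree_X_sub_C,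
      add_comm]
  by_cases hg0 : g = 0
  · simp [hg0]
  have hgN : g.natDegree + 1 ≤ N := by
    rw [← hdiv c g hg0, ← hg]
    exact (Polynomial.natDegree_sub_C).le.trans hfN
  have hX : ∀ s : Polynomial ℝ, (X * s).natDegree ≤ s.natDegree + 1 := fun s =>
    Polynomial.natDegree_mul_le.trans (by rw [Polynomial.natDegree_X, add_comm])
  have hY : ∀ (a : ℝ) (s : Polynomial ℝ), ((X - C a) * s).natDegree ≤ s.natDegree + 1 :=
    fun a s => Polynomial.natDegree_mul_le.trans (by rw [Polynomial.natDegree_X_sub_C, add_comm])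
  rcases hc.1.eq_or_lt with hc0 | hc0
  · subst hc0
    have := ih (N - 1) (by omega) (Λ ∘ₗ LinearMap.mulLeft ℝ X)
      (fun s hs => h1 s (by omega))
      (fun s hs => by
        have := h0 (X * s) (by have := hX s; omega)
        simpa [show X * (X * s ^ 2) = (X * s) ^ 2 by ring] using this)
      (fun s hs => by
        have := h3 s (by omega)
        simpa [mul_assoc] using this)
      (fun s hs => by
        have := h2 (X * s) (by have := hX s; omega)
        simpa [show X * (X * (C ℓ - X) * s ^ 2) = (C ℓ - X) * (X * s) ^ 2 by ring] using this)
      g (by omega)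
      (by
        have key : ∀ u ∈ Set.Icc 0 ℓ, u ≠ 0 → 0 ≤ g.eval u := by
          intro u hu hu0
          have h := hge u
          have h' := hmin' u hu
          have : 0 < u := lt_of_le_of_ne hu.1 hu0.symm
          by_contra! hneg
          nlinarith [mul_pos_of_neg_of_neg hneg (neg_neg_of_pos this)]
        intro u hu
        by_cases hu0 : u = 0
        · rw [hu0]; exact Polynomial.eval_nonneg_of_punctured hℓ hc g key
        · exact key u hu hu0)
    simpa using this
  rcases hc.2.eq_or_lt with hcl | hcl
  · subst hcl
    have := ih (N - 1) (by omega) (Λ ∘ₗ LinearMap.mulLeft ℝ (C c - X))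
      (fun s hs => h2 s (by omega))
      (fun s hs => by
        have := h3 s (by omega)
        simpa [show (C c - X) * (X * s ^ 2) = X * (C c - X) * s ^ 2 by ring] using this)
      (fun s hs => by
        have := h0 ((X - C c) * s) (by have := hY c s; omega)
        simpa [show (C c - X) * ((C c - X) * s ^ 2) = ((X - C c) * s) ^ 2 by ring] using this)
      (fun s hs => by
        have := h1 ((X - C c) * s) (by have := hY c s; omega)
        simpa [show (C c - X) * (X * (C c - X) * s ^ 2) = X * ((X - C c) * s) ^ 2 by ring]
          using this)
      (-g) (by rw [Polynomial.natDegree_neg]; omega)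
      (by
        have key : ∀ u ∈ Set.Icc 0 c, u ≠ c → 0 ≤ (-g).eval u := by
          intro u hu hu0
          have h := hge u
          have h' := hmin' u hu
          have : 0 < c - u := sub_pos.2 (lt_of_le_of_ne hu.2 hu0)
          rw [Polynomial.eval_neg]
          by_contra! hneg
          nlinarith [mul_pos_of_neg_of_neg hneg (neg_neg_of_pos this)]
        intro u hu
        by_cases hu0 : u = c
        · rw [hu0]; exact Polynomial.eval_nonneg_of_punctured hℓ hc (-g) key
        · exact key u hu hu0)
    have e : (C c - X) * -g = (X - C c) * g := by ring
    simpa [-mul_neg, e] using this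
  · have hpos : ∀ u ∈ Set.Icc 0 ℓ, 0 ≤ (u - c) * g.eval u := by
      intro u hu
      rw [← hge]; linarith [hmin' u hu]
    have hgc : g.eval c = 0 := by
      apply le_antisymm
      · have := Polynomial.eval_nonneg_of_punctured (c := c) hc0 ⟨hc0.le, le_rfl⟩ (-g) (by
          intro u hu hu0
          have h := hpos u ⟨hu.1, hu.2.trans hc.2⟩
          have : 0 < c - u := sub_pos.2 (lt_of_le_of_ne hu.2 hu0)
          rw [Polynomial.eval_neg]
          by_contra! hneg
          nlinarith [mul_pos_of_neg_of_neg hneg (neg_neg_of_pos this)])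
        rw [Polynomial.eval_neg] at this
        linarith
      · exact Polynomial.eval_nonneg_of_punctured (c := c) hcl ⟨le_rfl, hcl.le⟩ g (by
          intro u hu hu0
          have h := hpos u ⟨hc.1.trans hu.1, hu.2⟩
          have : 0 < u - c := sub_pos.2 (lt_of_le_of_ne hu.1 hu0.symm)
          by_contra! hneg
          nlinarith [mul_pos_of_neg_of_neg hneg (neg_neg_of_pos this)])
    obtain ⟨p, rfl⟩ : (X - C c) ∣ g := Polynomial.dvd_iff_isRoot.2 hgc
    have hp0 : p ≠ 0 := right_ne_zero_of_mul hg0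
    rw [hdiv c p hp0] at hgN
    have := ih (N - 2) (by omega) (Λ ∘ₗ LinearMap.mulLeft ℝ ((X - C c) ^ 2))
      (fun s hs => by
        have := h0 ((X - C c) * s) (by have := hY c s; omega)
        simpa [mul_pow] using this)
      (fun s hs => by
        have := h1 ((X - C c) * s) (by have := hY c s; omega)
        simpa [show (X - C c) ^ 2 * (X * s ^ 2) = X * ((X - C c) * s) ^ 2 by ring] using this)
      (fun s hs => by
        have := h2 ((X - C c) * s) (by have := hY c s; omega)
        simpa [show (X - C c) ^ 2 * ((C ℓ - X) * s ^ 2) = (C ℓ - X) * ((X - C c) * s) ^ 2 by ring]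
          using this)
      (fun s hs => by
        have := h3 ((X - C c) * s) (by have := hY c s; omega)
        simpa [show (X - C c) ^ 2 * (X * (C ℓ - X) * s ^ 2) =
          X * (C ℓ - X) * ((X - C c) * s) ^ 2 by ring] using this)
      p (by omega)
      (by
        have key : ∀ u ∈ Set.Icc 0 ℓ, u ≠ c → 0 ≤ p.eval u := by
          intro u hu hu0
          have h := hpos u hu
          have : 0 < (u - c) ^ 2 := by have := sub_ne_zero.2 hu0; positivity
          simp only [Polynomial.eval_mul, Polynomial.eval_sub, Polynomial.eval_X,
            Polynomial.eval_C] at h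
          by_contra! hneg
          nlinarith [mul_neg_of_pos_of_neg this hneg]
        intro u hu
        by_cases hu0 : u = c
        · rw [hu0]; exact Polynomial.eval_nonneg_of_punctured hℓ hc p key
        · exact key u hu hu0)
    have e : (X - C c) ^ 2 * p = (X - C c) * ((X - C c) * p) := by ring
    simpa [e] using this

theorem isSOS_iff_isSumSq {V : Type*} {p : MvPolynomial V ℝ} : IsSOS p ↔ IsSumSq p := by
  constructor
  · rintro ⟨N, q, rfl⟩
    exact IsSumSq.sum_sq _ _
  · intro h
    induction h with
    | zero => exact ⟨0, Fin.elim0, by simp⟩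
    | sq_add a _ ih =>
      obtain ⟨N, q, rfl⟩ := ih
      exact ⟨N + 1, Fin.cons a q, by simp [Fin.sum_univ_succ, sq]⟩

theorem IsSumSq.sq {R : Type*} [CommSemiring R] (a : R) : IsSumSq (a ^ 2) := by
  rw [pow_two]; exact IsSumSq.mul_self a

theorem IsSumSq.map {R S : Type*} [CommSemiring R] [CommSemiring S] (f : R →+* S) {a : R}
    (h : IsSumSq a) : IsSumSq (f a) := by
  induction h with
  | zero => rw [map_zero]; exact IsSumSq.zero
  | sq_add a _ ih => rw [map_add, map_mul]; exact IsSumSq.sq_add _ ih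

namespace MvPolynomial

variable {V V' : Type*}

theorem totalDegree_mul_le {p q : MvPolynomial V ℝ} {a b : ℕ} (hp : p.totalDegree ≤ a)
    (hq : q.totalDegree ≤ b) : (p * q).totalDegree ≤ a + b :=
  (totalDegree_mul p q).trans (add_le_add hp hq)

theorem totalDegree_pow_le {p : MvPolynomial V ℝ} {a : ℕ} (hp : p.totalDegree ≤ a) (k : ℕ) :
    (p ^ k).totalDegree ≤ k * a :=
  (totalDegree_pow p k).trans (Nat.mul_le_mul_left k hp)

theorem totalDegree_add_le {p q : MvPolynomial V ℝ} {a : ℕ} (hp : p.totalDegree ≤ a)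
    (hq : q.totalDegree ≤ a) : (p + q).totalDegree ≤ a :=
  (totalDegree_add p q).trans (max_le hp hq)

theorem totalDegree_sub_le {p q : MvPolynomial V ℝ} {a : ℕ} (hp : p.totalDegree ≤ a)
    (hq : q.totalDegree ≤ a) : (p - q).totalDegree ≤ a :=
  (totalDegree_sub p q).trans (max_le hp hq)

theorem totalDegree_C_le (c : ℝ) (a : ℕ) : (C c : MvPolynomial V ℝ).totalDegree ≤ a := by
  simp

theorem totalDegree_C_mul_le {p : MvPolynomial V ℝ} {a : ℕ} (c : ℝ) (hp : p.totalDegree ≤ a) :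
    (C c * p).totalDegree ≤ a := by
  simpa using totalDegree_mul_le (totalDegree_C_le c 0) hp

/-- Substituting polynomials of degree at most one does not increase the total degree. -/
theorem totalDegree_aeval_le (σ : V → MvPolynomial V' ℝ) (hσ : ∀ k, (σ k).totalDegree ≤ 1)
    (p : MvPolynomial V ℝ) : (aeval σ p).totalDegree ≤ p.totalDegree := by
  rw [aeval_def, eval₂_eq]
  refine totalDegree_finsetSum_le fun d hd => ?_
  rw [algebraMap_eq]
  refine totalDegree_C_mul_le _ ((totalDegree_finsetProd _ _).trans ?_)
  refine le_trans (Finset.sum_le_sum fun i _ => ?_) (le_totalDegree hd)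
  simpa using totalDegree_pow_le (hσ i) (d i)

theorem totalDegree_polynomial_aeval_le {U : MvPolynomial V ℝ} {a : ℕ} (hU : U.totalDegree ≤ a)
    (q : Polynomial ℝ) : (Polynomial.aeval U q).totalDegree ≤ q.natDegree * a := by
  rw [Polynomial.aeval_eq_sum_range]
  refine totalDegree_finsetSum_le fun j hj => ?_
  refine (totalDegree_smul_le _ _).trans ((totalDegree_pow_le hU j).trans ?_)
  exact Nat.mul_le_mul_right a (Nat.lt_succ_iff.1 (Finset.mem_range.1 hj))

theorem map_C_mul (E : MvPolynomial V ℝ →ₗ[ℝ] ℝ) (c : ℝ) (p : MvPolynomial V ℝ) :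
    E (C c * p) = c * E p := by
  rw [C_mul', map_smul, smul_eq_mul]

/-- Cauchy–Schwarz inequality for functionals nonnegative on squares. -/
theorem map_mul_sq_le {E : MvPolynomial V ℝ →ₗ[ℝ] ℝ} {d : ℕ}
    (hE : ∀ p : MvPolynomial V ℝ, p.totalDegree ≤ d → 0 ≤ E (p ^ 2)) {a b : MvPolynomial V ℝ}
    (ha : a.totalDegree ≤ d) (hb : b.totalDegree ≤ d) :
    E (a * b) ^ 2 ≤ E (a ^ 2) * E (b ^ 2) := by
  have h : ∀ t : ℝ, 0 ≤ E (a ^ 2) * (t * t) + 2 * E (a * b) * t + E (b ^ 2) := by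
    intro t
    have h := hE (C t * a + b) (totalDegree_add_le (totalDegree_C_mul_le t ha) hb)
    have e : (C t * a + b) ^ 2 = C (t * t) * a ^ 2 + C (2 * t) * (a * b) + b ^ 2 := by
      simp only [C_mul, map_ofNat]; ring
    rw [e, map_add, map_add, map_C_mul, map_C_mul] at h
    linarith
  have := discrim_le_zero h
  rw [discrim] at this
  linarith

section Weighted

variable {E : MvPolynomial V ℝ →ₗ[ℝ] ℝ} {L : ℕ} {ω U W : MvPolynomial V ℝ} {ℓ : ℝ}

theorem map_idem_mul_self_mul_eq_zero (hω : ω.totalDegree ≤ 1)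
    (hidem : ∀ h, IsSumSq h → h.totalDegree + 2 ≤ L → E (h * (ω - ω ^ 2)) = 0)
    {h : MvPolynomial V ℝ} (hh : IsSumSq h) (hd : h.totalDegree + 4 ≤ L) :
    E (h * ω * (ω - ω ^ 2)) = 0 := by
  have key : ∀ c : ℝ, E ((h * (ω + C c) ^ 2) * (ω - ω ^ 2)) = 0 := by
    intro c
    refine hidem _ (hh.mul (.sq _)) ?_
    have := totalDegree_mul_le le_rfl
      (totalDegree_pow_le (totalDegree_add_le hω (totalDegree_C_le c 1)) 2) (p := h)
    omega
  have e : C 4 * (h * ω * (ω - ω ^ 2)) = (h * (ω + C 1) ^ 2) * (ω - ω ^ 2) -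
      (h * (ω + C (-1)) ^ 2) * (ω - ω ^ 2) := by
    simp only [C_neg, C_1, map_ofNat]; ring
  have := congrArg E e
  rw [map_C_mul, map_sub, key, key] at this
  linarith

/-- Lower bound for the weighted square of the linear polynomial `1 - c u`. -/
theorem le_map_mul_one_sub_sq (hL : 6 ≤ L) (hω : ω.totalDegree ≤ 1)
    (hU : U.totalDegree ≤ 2) (hW : W.totalDegree ≤ 2) (hWs : IsSumSq W)
    (hsos : ∀ h, IsSumSq h → h.totalDegree ≤ L → 0 ≤ E h)
    (hidem : ∀ h, IsSumSq h → h.totalDegree + 2 ≤ L → E (h * (ω - ω ^ 2)) = 0)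
    (hres : ∀ h, IsSumSq h → h.totalDegree + 4 ≤ L → 0 ≤ E (h * (C ℓ - ω * U)))
    {c t : ℝ} (hc : 0 ≤ c) (ht : 0 ≤ t) :
    (2 * t - t ^ 2) * E (ω * W) - 2 * t * c * ℓ * E W ≤ E (W * (1 - C c * U) ^ 2) := by
  have h1 := hsos (W * (C c * U - 1 + C t * ω) ^ 2) (hWs.mul (.sq _)) (by
    have h : (C c * U - 1 + C t * ω).totalDegree ≤ 2 :=
      totalDegree_add_le (totalDegree_sub_le (totalDegree_C_mul_le c hU) (by simp))
        (totalDegree_C_mul_le t (hω.trans one_le_two))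
    have := totalDegree_mul_le hW (totalDegree_pow_le h 2)
    omega)
  have h2 := hidem W hWs (by omega)
  have h3 := hres W hWs (by omega)
  have e : W * (1 - C c * U) ^ 2 = W * (C c * U - 1 + C t * ω) ^ 2 + C (2 * t - t ^ 2) * (ω * W) -
      C (2 * t * c * ℓ) * W + C (2 * t * c) * (W * (C ℓ - ω * U)) +
      C (t ^ 2) * (W * (ω - ω ^ 2)) := by
    simp only [C_mul, C_sub, C_pow, map_ofNat]; ring
  rw [e, map_add, map_add, map_sub, map_add, map_C_mul, map_C_mul, map_C_mul, map_C_mul, h2]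
  have := mul_nonneg (mul_nonneg (mul_nonneg zero_le_two ht) hc) h3
  linarith

/-- Lower bound for the weighted square of a polynomial of degree at least two which is bounded
below by `κ` on `[0, ℓ]`. -/
theorem le_map_mul_aeval_sq (hω : ω.totalDegree ≤ 1)
    (hU : U.totalDegree ≤ 2) (hUs : IsSumSq U) (hW : W.totalDegree ≤ 2) (hWs : IsSumSq W)
    (hsos : ∀ h, IsSumSq h → h.totalDegree ≤ L → 0 ≤ E h)
    (hidem : ∀ h, IsSumSq h → h.totalDegree + 2 ≤ L → E (h * (ω - ω ^ 2)) = 0)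
    (hres : ∀ h, IsSumSq h → h.totalDegree + 4 ≤ L → 0 ≤ E (h * (C ℓ - ω * U)))
    (hℓ : 0 < ℓ) {q : Polynomial ℝ} (hq : 2 ≤ q.natDegree) (hqL : 4 * q.natDegree + 2 ≤ L)
    {κ : ℝ} (hκ : 0 ≤ κ) (hqκ : ∀ u ∈ Set.Icc 0 ℓ, κ ≤ q.eval u) :
    κ ^ 2 * E (ω * W) ≤ E (W * Polynomial.aeval U q ^ 2) := by
  have hidem' : ∀ h : MvPolynomial V ℝ, IsSumSq h → h.totalDegree + 4 ≤ L →
      E (h * ω * (ω - ω ^ 2)) = 0 := fun h hh hd =>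
    map_idem_mul_self_mul_eq_zero hω hidem hh hd
  have hres' : ∀ h, IsSumSq h → h.totalDegree + 6 ≤ L → 0 ≤ E (ω ^ 2 * (h * (C ℓ - U))) := by
    intro h hh hd
    have h1 := hres (h * ω ^ 2) (hh.mul (.sq _)) (by
      have := totalDegree_mul_le le_rfl (totalDegree_pow_le hω 2) (p := h)
      omega)
    have h2 := hidem' (h * U) (hh.mul hUs) (by
      have := totalDegree_mul_le le_rfl hU (p := h)
      omega)
    have e : ω ^ 2 * (h * (C ℓ - U)) = h * ω ^ 2 * (C ℓ - ω * U) - h * U * ω * (ω - ω ^ 2) := by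
      ring
    rw [e, map_sub, h2]
    linarith
  have hω2 : (ω ^ 2).totalDegree ≤ 2 := by simpa using totalDegree_pow_le hω 2
  have haev : ∀ s : Polynomial ℝ, (Polynomial.aeval U s ^ 2).totalDegree ≤ 4 * s.natDegree := by
    intro s
    have := totalDegree_pow_le (totalDegree_polynomial_aeval_le hU s) 2
    omega
  have hWa : ∀ s : Polynomial ℝ,
      (W * Polynomial.aeval U s ^ 2).totalDegree ≤ 2 + 4 * s.natDegree := fun s =>
    totalDegree_mul_le hW (haev s)
  have hcert : 0 ≤ E (ω ^ 2 * (W * Polynomial.aeval U (q - Polynomial.C κ))) := by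
    refine Polynomial.linearMap_nonneg_of_nonneg_on_Icc hℓ q.natDegree
      (E ∘ₗ LinearMap.mulLeft ℝ (ω ^ 2) ∘ₗ LinearMap.mulLeft ℝ W ∘ₗ
        (Polynomial.aeval U).toLinearMap) ?_ ?_ ?_ ?_ _ (Polynomial.natDegree_sub_C).le ?_
    · intro s hs
      have := hsos (ω ^ 2 * (W * Polynomial.aeval U s ^ 2))
        ((IsSumSq.sq _).mul (hWs.mul (.sq _))) (by
          have := totalDegree_mul_le hω2 (hWa s)
          omega)
      simpa using this
    · intro s hs
      have := hsos (ω ^ 2 * (W * (U * Polynomial.aeval U s ^ 2)))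
        ((IsSumSq.sq _).mul (hWs.mul (hUs.mul (.sq _)))) (by
          have := totalDegree_mul_le hω2 (totalDegree_mul_le hW (totalDegree_mul_le hU (haev s)))
          omega)
      simpa using this
    · intro s hs
      have := hres' (W * Polynomial.aeval U s ^ 2) (hWs.mul (.sq _)) (by
        have := hWa s
        omega)
      have e : ω ^ 2 * (W * Polynomial.aeval U s ^ 2 * (C ℓ - U)) =
        ω ^ 2 * (W * ((C ℓ - U) * Polynomial.aeval U s ^ 2)) := by ring
      rw [e] at this
      simpa [algebraMap_eq] using this
    · intro s hs
      have := hres' (W * (U * Polynomial.aeval U s ^ 2)) (hWs.mul (hUs.mul (.sq _))) (by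
        have := totalDegree_mul_le hW (totalDegree_mul_le hU (haev s))
        omega)
      have e : ω ^ 2 * (W * (U * Polynomial.aeval U s ^ 2) * (C ℓ - U)) =
        ω ^ 2 * (W * (U * (C ℓ - U) * Polynomial.aeval U s ^ 2)) := by ring
      rw [e] at this
      simpa [algebraMap_eq] using this
    · intro u hu
      simpa using hqκ u hu
  have hsq := hsos (W * (Polynomial.aeval U q - C κ * ω ^ 2) ^ 2) (hWs.mul (.sq _)) (by
    have h : (Polynomial.aeval U q - C κ * ω ^ 2).totalDegree ≤ 2 * q.natDegree :=
      totalDegree_sub_le ((totalDegree_polynomial_aeval_le hU q).trans (by omega))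
        (totalDegree_C_mul_le κ (hω2.trans (by omega)))
    have := totalDegree_mul_le hW (totalDegree_pow_le h 2)
    omega)
  have i1 := hidem W hWs (by omega)
  have i2 := hidem' W hWs (by omega)
  have i3 := hidem (W * ω ^ 2) (hWs.mul (.sq _)) (by
    have := totalDegree_mul_le hW hω2
    omega)
  have e : W * Polynomial.aeval U q ^ 2 = W * (Polynomial.aeval U q - C κ * ω ^ 2) ^ 2 +
      C (2 * κ) * (ω ^ 2 * (W * Polynomial.aeval U (q - Polynomial.C κ))) +
      C (κ ^ 2) * (ω * W) + C (κ ^ 2) * (W * ω ^ 2 * (ω - ω ^ 2)) +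
      C (κ ^ 2) * (W * ω * (ω - ω ^ 2)) - C (κ ^ 2) * (W * (ω - ω ^ 2)) := by
    simp only [C_mul, C_pow, map_ofNat, map_sub, Polynomial.aeval_C, algebraMap_eq]; ring
  rw [e]
  simp only [map_add, map_sub, map_C_mul, i1, i2, i3]
  rw [map_sub] at hcert
  have := mul_nonneg (mul_nonneg zero_le_two hκ) hcert
  simp only [map_sub, mul_sub] at this ⊢
  linarith

end Weighted

end MvPolynomial

section AntiConcentration

variable {n dx dy : ℕ}

theorem SosProof.eval_nonneg {V ι : Type*} [Fintype ι] [DecidableEq ι] {A : ι → MvPolynomial V ℝ}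
    {k : ℕ} {g : MvPolynomial V ℝ} (h : SosProof A k g) {v : V → ℝ}
    (hv : ∀ i, 0 ≤ eval v (A i)) : 0 ≤ eval v g := by
  obtain ⟨P, hP, rfl, -⟩ := h
  rw [map_sum]
  refine Finset.sum_nonneg fun S _ => ?_
  rw [map_mul, map_prod]
  exact mul_nonneg ((isSOS_iff_isSumSq.1 (hP S)).map (eval v)).nonneg
    (Finset.prod_nonneg fun i _ => hv i)

theorem SosProof.totalDegree_le {V ι : Type*} [Fintype ι] [DecidableEq ι]
    {A : ι → MvPolynomial V ℝ} {k : ℕ} {g : MvPolynomial V ℝ} (h : SosProof A k g) :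
    g.totalDegree ≤ k := by
  obtain ⟨P, -, rfl, hd⟩ := h
  exact totalDegree_finsetSum_le fun S _ => hd S

theorem eval_polynomial_aeval {V : Type*} (v : V → ℝ) (U : MvPolynomial V ℝ) (q : Polynomial ℝ) :
    eval v (Polynomial.aeval U q) = q.eval (eval v U) := by
  rw [← coe_aeval_eq_eval]
  exact (Polynomial.aeval_algHom_apply (aeval v : MvPolynomial V ℝ →ₐ[ℝ] ℝ) U q).symm

theorem eval_normAPoly (A : Fin n → Matrix (Fin dx) (Fin dy) ℝ) (i : Fin n) (v : Fin dx → ℝ) :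
    eval v (normAPoly A i) = ∑ j, (∑ k, A i k j * v k) ^ 2 := by
  simp [normAPoly]

theorem eval_normAPoly_smul (A : Fin n → Matrix (Fin dx) (Fin dy) ℝ) (i : Fin n)
    (v : Fin dx → ℝ) (t : ℝ) :
    eval (t • v) (normAPoly A i) = t ^ 2 * eval v (normAPoly A i) := by
  simp only [eval_normAPoly, Finset.mul_sum, ← mul_pow, Pi.smul_apply, smul_eq_mul]
  refine Finset.sum_congr rfl fun j _ => ?_
  congr 1
  exact Finset.sum_congr rfl fun k _ => by ring

theorem eval_vnormPoly (v : Fin dx → ℝ) : eval v (vnormPoly dx) = ∑ k, v k ^ 2 := by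
  simp [vnormPoly]

/-- Anti-concentration upper bound at a point. -/
theorem SosProof.antiConcentration_le {A : Fin n → Matrix (Fin dx) (Fin dy) ℝ}
    {I : Finset (Fin n)} {k : ℕ} {M b : ℝ} {q : Polynomial ℝ}
    (h : SosProof (fun _ : Fin 1 => C (M ^ 2) - vnormPoly dx) k
      (C b - vnormPoly dx *
        (C ((I.card : ℝ)⁻¹) * ∑ i ∈ I, Polynomial.aeval (normAPoly A i) q ^ 2)))
    {v : Fin dx → ℝ} (hv : ∑ k, v k ^ 2 ≤ M ^ 2) :
    (∑ k, v k ^ 2) * ((I.card : ℝ)⁻¹ * ∑ i ∈ I, q.eval (eval v (normAPoly A i)) ^ 2) ≤ b := by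
  have := h.eval_nonneg (v := v) (by simpa [eval_vnormPoly] using hv)
  simpa [eval_vnormPoly, eval_polynomial_aeval] using this

theorem Polynomial.coeff_aeval_C_mul_X_sq_sq (q : Polynomial ℝ) (u : ℝ) :
    ((Polynomial.aeval (Polynomial.C u * Polynomial.X ^ 2) q) ^ 2).coeff (4 * q.natDegree) =
      (q.leadingCoeff * u ^ q.natDegree) ^ 2 := by
  have e : Polynomial.aeval (Polynomial.C u * Polynomial.X ^ 2) q =
      Polynomial.expand ℝ 2 (q.comp (Polynomial.C u * Polynomial.X)) := by
    rw [Polynomial.expand_eq_comp_X_pow, Polynomial.comp_assoc, Polynomial.comp_eq_aeval]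
    simp
  rw [e, ← map_pow, show 4 * q.natDegree = 2 * (2 * q.natDegree) by ring,
    Polynomial.coeff_expand_mul' two_pos, Polynomial.coeff_pow_of_natDegree_le,
    Polynomial.comp_C_mul_X_coeff, Polynomial.leadingCoeff]
  rw [Polynomial.natDegree_comp]
  exact (Nat.mul_le_mul_left _ (by simpa using Polynomial.natDegree_C_mul_X_pow_le u 1)).trans
    (mul_one _).le

theorem aeval_line_vnormPoly (v : Fin dx → ℝ) :
    aeval (fun j => Polynomial.C (v j) * Polynomial.X) (vnormPoly dx) =
      Polynomial.C (∑ j, v j ^ 2) * Polynomial.X ^ 2 := by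
  simp [vnormPoly, mul_pow, Finset.sum_mul]

theorem aeval_line_normAPoly (A : Fin n → Matrix (Fin dx) (Fin dy) ℝ) (i : Fin n)
    (v : Fin dx → ℝ) :
    aeval (fun j => Polynomial.C (v j) * Polynomial.X) (normAPoly A i) =
      Polynomial.C (eval v (normAPoly A i)) * Polynomial.X ^ 2 := by
  rw [eval_normAPoly]
  simp only [normAPoly, map_sum, map_pow, map_mul, aeval_X, aeval_C, Finset.sum_mul,
    Polynomial.algebraMap_eq, ← mul_pow]
  refine Finset.sum_congr rfl fun j _ => ?_
  congr 1
  exact Finset.sum_congr rfl fun k _ => by ring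

theorem natDegree_aeval_line_le {p : MvPolynomial (Fin dx) ℝ} {k : ℕ} (hp : p.totalDegree ≤ k)
    (v : Fin dx → ℝ) :
    (aeval (fun j => Polynomial.C (v j) * Polynomial.X) p).natDegree ≤ k := by
  have h := aeval_natDegree_le p hp (fun j => Polynomial.C (v j) * Polynomial.X) (n := 1)
    (fun j => by simpa using Polynomial.natDegree_C_mul_X_pow_le (v j) 1)
  rwa [mul_one] at h

theorem coeff_aeval_line (A : Fin n → Matrix (Fin dx) (Fin dy) ℝ) (I : Finset (Fin n)) (a : ℝ)
    (q : Polynomial ℝ) (v : Fin dx → ℝ) :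
    (aeval (fun j => Polynomial.C (v j) * Polynomial.X) (vnormPoly dx *
      (C a * ∑ i ∈ I, Polynomial.aeval (normAPoly A i) q ^ 2))).coeff (4 * q.natDegree + 2) =
      (∑ j, v j ^ 2) * (a *
        ∑ i ∈ I, (q.leadingCoeff * eval v (normAPoly A i) ^ q.natDegree) ^ 2) := by
  rw [map_mul, map_mul, map_sum, aeval_line_vnormPoly, aeval_C, Polynomial.algebraMap_eq,
    mul_assoc, Polynomial.coeff_C_mul, Polynomial.coeff_X_pow_mul, Polynomial.coeff_C_mul,
    Polynomial.finsetSum_coeff]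
  congr 2
  refine Finset.sum_congr rfl fun i _ => ?_
  rw [map_pow, ← Polynomial.coeff_aeval_C_mul_X_sq_sq, ← aeval_line_normAPoly,
    Polynomial.aeval_algHom_apply]

/-- If the linear maps do not all vanish, the certificate bounds the degree of `q`. -/
theorem SosProof.natDegree_le {A : Fin n → Matrix (Fin dx) (Fin dy) ℝ}
    {I : Finset (Fin n)} {k : ℕ} {B : MvPolynomial (Fin dx) ℝ} {b : ℝ} {q : Polynomial ℝ}
    (h : SosProof (fun _ : Fin 1 => B) k
      (C b - vnormPoly dx *
        (C ((I.card : ℝ)⁻¹) * ∑ i ∈ I, Polynomial.aeval (normAPoly A i) q ^ 2)))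
    (hq : q ≠ 0) {i : Fin n} (hi : i ∈ I) {v : Fin dx → ℝ} (hv : 0 < eval v (normAPoly A i)) :
    4 * q.natDegree + 2 ≤ k := by
  have hTk := totalDegree_sub_le (totalDegree_C_le b k) h.totalDegree_le
  rw [sub_sub_cancel] at hTk
  refine le_trans (Polynomial.le_natDegree_of_ne_zero ?_) (natDegree_aeval_line_le hTk v)
  rw [coeff_aeval_line]
  have hlc : q.leadingCoeff ≠ 0 := Polynomial.leadingCoeff_ne_zero.2 hq
  have hcard : (0 : ℝ) < I.card := Nat.cast_pos.2 (Finset.card_pos.2 ⟨i, hi⟩)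
  have hsum : 0 < ∑ i ∈ I, (q.leadingCoeff * eval v (normAPoly A i) ^ q.natDegree) ^ 2 :=
    Finset.sum_pos' (fun _ _ => sq_nonneg _)
      ⟨i, hi, sq_pos_of_ne_zero (mul_ne_zero hlc (pow_ne_zero _ hv.ne'))⟩
  have hvpos : 0 < ∑ j, v j ^ 2 := by
    refine (Finset.sum_nonneg fun j _ => sq_nonneg (v j)).lt_of_ne' fun h0 => hv.ne' ?_
    have hz : ∀ j, v j = 0 := fun j => by
      simpa using (Finset.sum_eq_zero_iff_of_nonneg fun j _ => sq_nonneg (v j)).1 h0 j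
        (Finset.mem_univ j)
    simp [eval_normAPoly, hz]
  exact (mul_pos hvpos (mul_pos (inv_pos.2 hcard) hsum)).ne'

/-- The lower anti-concentration bound propagates from `q ^ 2` to `q` on `[0, δ ^ 2]`. -/
theorem le_eval_of_sosProof {A : Fin n → Matrix (Fin dx) (Fin dy) ℝ} {i : Fin n} {k : ℕ}
    {δ κ : ℝ} {q : Polynomial ℝ}
    (h : SosProof (fun _ : Fin 1 => C (δ ^ 2) - normAPoly A i) k
        (Polynomial.aeval (normAPoly A i) q ^ 2 - C (κ ^ 2)))
    (hκ : 0 < κ) (hq : q.eval 0 = 1) {v : Fin dx → ℝ} (hv : 0 < eval v (normAPoly A i)) :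
    ∀ u ∈ Set.Icc 0 (δ ^ 2), κ ≤ q.eval u := by
  have hsq : ∀ u ∈ Set.Icc 0 (δ ^ 2), κ ^ 2 ≤ q.eval u ^ 2 := by
    intro u hu
    have hu' : eval (√(u / eval v (normAPoly A i)) • v) (normAPoly A i) = u := by
      rw [eval_normAPoly_smul, Real.sq_sqrt (div_nonneg hu.1 hv.le), div_mul_cancel₀ _ hv.ne']
    have := h.eval_nonneg (v := √(u / eval v (normAPoly A i)) • v) (by simpa [hu'] using hu.2)
    simpa [eval_polynomial_aeval, hu'] using this
  intro u hu
  by_contra! hlt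
  have hneg : q.eval u ≤ 0 := by
    by_contra! hpos
    nlinarith [hsq u hu]
  obtain ⟨w, hw, hw0⟩ := intermediate_value_Icc' hu.1 q.continuous.continuousOn
    (show (0 : ℝ) ∈ Set.Icc (q.eval u) (q.eval 0) from ⟨hneg, by rw [hq]; exact zero_le_one⟩)
  have hw' := hsq w ⟨hw.1, hw.2.trans hu.2⟩
  simp only at hw0
  rw [hw0] at hw'
  nlinarith

end AntiConcentration

section PseudoExpectation

/-- The pseudo-expectation as a linear functional on polynomials. -/
def pseudoExpect {V : Type*} (μ : (V → ℝ) →₀ ℝ) : MvPolynomial V ℝ →ₗ[ℝ] ℝ :=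
  ∑ z ∈ μ.support, μ z • (aeval z : MvPolynomial V ℝ →ₐ[ℝ] ℝ).toLinearMap

theorem pseudoExpect_apply {V : Type*} (μ : (V → ℝ) →₀ ℝ) (p : MvPolynomial V ℝ) :
    pseudoExpect μ p = pExpect μ fun z => eval z p := by
  simp [pseudoExpect, pExpect]

theorem IsPseudoDist.pseudoExpect_one {V : Type*} {μ : (V → ℝ) →₀ ℝ} {ℓ : ℕ}
    (h : IsPseudoDist μ ℓ) : pseudoExpect μ 1 = 1 := by
  simpa [pseudoExpect_apply, pExpect] using h.1

section

variable {V ι : Type*} [Fintype ι] [DecidableEq ι] {μ : (V → ℝ) →₀ ℝ} {ℓ : ℕ}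
  {A : ι → MvPolynomial V ℝ} {h : MvPolynomial V ℝ} {d : ℕ}

theorem PDSatisfies.pseudoExpect_nonneg (hsat : PDSatisfies μ ℓ A 0) (hh : IsSumSq h)
    (hd : h.totalDegree ≤ ℓ) : 0 ≤ pseudoExpect μ h := by
  have := hsat ∅ h (isSOS_iff_isSumSq.2 hh) (by simpa using hd)
  simpa [pseudoExpect_apply] using this

theorem PDSatisfies.pseudoExpect_mul_nonneg (hsat : PDSatisfies μ ℓ A 0) (hh : IsSumSq h) (i : ι)
    (hi : (A i).totalDegree ≤ d) (hd : h.totalDegree + d ≤ ℓ) :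
    0 ≤ pseudoExpect μ (h * A i) := by
  have := hsat {i} h (isSOS_iff_isSumSq.2 hh) (by simpa using (add_le_add_right hi _).trans hd)
  simpa [pseudoExpect_apply] using this

theorem PDSatisfies.pseudoExpect_mul_eq_zero (hsat : PDSatisfies μ ℓ A 0) (hh : IsSumSq h)
    {i j : ι} (hij : A j = -A i) (hi : (A i).totalDegree ≤ d) (hd : h.totalDegree + d ≤ ℓ) :
    pseudoExpect μ (h * A i) = 0 := by
  refine le_antisymm ?_ (hsat.pseudoExpect_mul_nonneg hh i hi hd)
  have := hsat.pseudoExpect_mul_nonneg hh j (by rwa [hij, totalDegree_neg]) hd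
  rw [hij, mul_neg, map_neg] at this
  linarith

theorem PDSatisfies.pseudoExpect_sq_eq_zero (hsat : PDSatisfies μ ℓ A 0)
    {i j : ι} (hne : i ≠ j) (hij : A j = -A i) (hi : (A i).totalDegree ≤ d) (hd : 2 * d ≤ ℓ) :
    pseudoExpect μ (A i ^ 2) = 0 := by
  refine le_antisymm ?_ (hsat.pseudoExpect_nonneg (.sq _) ((totalDegree_pow_le hi 2).trans hd))
  have := hsat {i, j} 1 (isSOS_iff_isSumSq.2 IsSumSq.one) (by
    rw [Finset.sum_pair hne, hij, totalDegree_neg]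
    simp
    omega)
  rw [← pseudoExpect_apply, Finset.prod_pair hne, hij, one_mul, mul_neg, ← pow_two, map_neg] at this
  linarith

end

/-- The polynomials `x_k - x°_k`. -/
def errPoly (n : ℕ) {dx : ℕ} (x0 : Fin dx → ℝ) (k : Fin dx) : MvPolynomial (Fin n ⊕ Fin dx) ℝ :=
  X (Sum.inr k) - C (x0 k)

variable {n dx dy mX : ℕ}

theorem totalDegree_errPoly_le (x0 : Fin dx → ℝ) (k : Fin dx) :
    (errPoly n x0 k).totalDegree ≤ 1 :=
  totalDegree_sub_le (totalDegree_X _).le (totalDegree_C_le _ _)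

theorem totalDegree_vnormPoly_le : (vnormPoly dx).totalDegree ≤ 2 :=
  totalDegree_finsetSum_le fun k _ => totalDegree_pow_le (totalDegree_X (R := ℝ) k).le 2

theorem totalDegree_normAPoly_le (A : Fin n → Matrix (Fin dx) (Fin dy) ℝ) (i : Fin n) :
    (normAPoly A i).totalDegree ≤ 2 :=
  totalDegree_finsetSum_le fun _ _ =>
    totalDegree_pow_le (totalDegree_finsetSum_le fun k _ =>
      totalDegree_C_mul_le _ (totalDegree_X (R := ℝ) k).le) 2

theorem totalDegree_residPoly_le (y : Fin n → Fin dy → ℝ)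
    (A : Fin n → Matrix (Fin dx) (Fin dy) ℝ) (i : Fin n) :
    (residPoly y A i).totalDegree ≤ 2 :=
  totalDegree_finsetSum_le fun _ _ =>
    totalDegree_pow_le (totalDegree_sub_le (totalDegree_C_le _ _)
      (totalDegree_finsetSum_le fun _ _ => totalDegree_C_mul_le _ (totalDegree_X (R := ℝ) _).le)) 2

theorem isSumSq_vnormPoly : IsSumSq (vnormPoly dx) := IsSumSq.sum_sq _ _

theorem isSumSq_normAPoly (A : Fin n → Matrix (Fin dx) (Fin dy) ℝ) (i : Fin n) :
    IsSumSq (normAPoly A i) := IsSumSq.sum_sq _ _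

theorem aeval_C_mul_vnormPoly {V : Type*} (s : ℝ) (σ : Fin dx → MvPolynomial V ℝ) :
    aeval (fun k => C s * σ k) (vnormPoly dx) = C (s ^ 2) * aeval σ (vnormPoly dx) := by
  simp [vnormPoly, mul_pow, Finset.mul_sum]

theorem aeval_C_mul_normAPoly {V : Type*} (A : Fin n → Matrix (Fin dx) (Fin dy) ℝ) (i : Fin n)
    (s : ℝ) (σ : Fin dx → MvPolynomial V ℝ) :
    aeval (fun k => C s * σ k) (normAPoly A i) = C (s ^ 2) * aeval σ (normAPoly A i) := by
  simp only [normAPoly, map_sum, map_pow, map_mul, aeval_X, aeval_C, Finset.mul_sum, ← mul_pow]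
  refine Finset.sum_congr rfl fun j _ => ?_
  congr 1
  exact Finset.sum_congr rfl fun k _ => by ring

section System

variable {y : Fin n → Fin dy → ℝ} {A : Fin n → Matrix (Fin dx) (Fin dy) ℝ}
  {g : Fin mX → MvPolynomial (Fin dx) ℝ} {cbar α : ℝ} {μ : (Fin n ⊕ Fin dx → ℝ) →₀ ℝ} {L : ℕ}
  {h : MvPolynomial (Fin n ⊕ Fin dx) ℝ}

theorem pseudoExpect_mul_idem (hsat : PDSatisfies μ L (sysT y A g cbar α) 0) (hh : IsSumSq h)
    (hd : h.totalDegree + 2 ≤ L) (i : Fin n) :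
    pseudoExpect μ (h * (X (Sum.inl i) - X (Sum.inl i) ^ 2)) = 0 :=
  hsat.pseudoExpect_mul_eq_zero (i := Sum.inr (Sum.inl i)) (j := Sum.inr (Sum.inr (Sum.inl i))) hh
    (by simp [sysT, sysM]) (totalDegree_sub_le (by simp) (by simp)) hd

theorem totalDegree_sum_inl_le :
    (∑ i, X (Sum.inl i) : MvPolynomial (Fin n ⊕ Fin dx) ℝ).totalDegree ≤ 1 :=
  totalDegree_finsetSum_le fun _ _ => (totalDegree_X (R := ℝ) _).le

theorem pseudoExpect_mul_sum (hsat : PDSatisfies μ L (sysT y A g cbar α) 0) (hh : IsSumSq h)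
    (hd : h.totalDegree + 1 ≤ L) :
    pseudoExpect μ (h * (C (α * n) - ∑ i, X (Sum.inl i))) = 0 :=
  hsat.pseudoExpect_mul_eq_zero (i := Sum.inl 0) (j := Sum.inl 1) hh
    (by simp [sysT]) (totalDegree_sub_le (totalDegree_C_le _ _) totalDegree_sum_inl_le) hd

theorem pseudoExpect_sum_sq (hsat : PDSatisfies μ L (sysT y A g cbar α) 0) (hL : 2 ≤ L) :
    pseudoExpect μ ((C (α * n) - ∑ i, X (Sum.inl i)) ^ 2) = 0 :=
  hsat.pseudoExpect_sq_eq_zero (i := Sum.inl 0) (j := Sum.inl 1) (d := 1) (by simp)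
    (by simp [sysT]) (totalDegree_sub_le (totalDegree_C_le _ _) totalDegree_sum_inl_le) hL

theorem pseudoExpect_mul_ball (hsat : PDSatisfies μ L (sysT y A g cbar α) 0) {Mx : ℝ}
    {j0 : Fin mX} (hj0 : g j0 = C (Mx ^ 2) - vnormPoly dx) {x0 : Fin dx → ℝ}
    (hx0 : ∑ k, x0 k ^ 2 ≤ Mx ^ 2) (hh : IsSumSq h) (hd : h.totalDegree + 2 ≤ L) :
    0 ≤ pseudoExpect μ (h * (C ((2 * Mx) ^ 2) - aeval (errPoly n x0) (vnormPoly dx))) := by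
  have h1 := hsat.pseudoExpect_mul_nonneg (d := 2) hh (Sum.inr (Sum.inr (Sum.inr (Sum.inr j0))))
    (by
      simp only [sysT, sysM, hj0]
      exact (totalDegree_rename_le _ _).trans
        (totalDegree_sub_le (totalDegree_C_le _ _) totalDegree_vnormPoly_le)) hd
  have h2 := hsat.pseudoExpect_nonneg hh (by omega)
  have h3 := hsat.pseudoExpect_nonneg (h := h * ∑ k, (X (Sum.inr k) + C (x0 k)) ^ 2)
    (hh.mul (IsSumSq.sum_sq _ _)) (le_trans (totalDegree_mul_le le_rfl
      (totalDegree_finsetSum_le fun k _ =>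
        totalDegree_pow_le (totalDegree_add_le (totalDegree_X (R := ℝ) _).le (by simp)) 2)) hd)
  have e : h * (C ((2 * Mx) ^ 2) - aeval (errPoly n x0) (vnormPoly dx)) =
      C 2 * (h * rename Sum.inr (C (Mx ^ 2) - vnormPoly dx)) +
      C (2 * (Mx ^ 2 - ∑ k, x0 k ^ 2)) * h + h * ∑ k, (X (Sum.inr k) + C (x0 k)) ^ 2 := by
    simp only [vnormPoly, errPoly, map_sum, map_pow, aeval_X, map_sub, rename_C, rename_X, map_mul,
      sub_sq, add_sq, Finset.sum_add_distrib, Finset.sum_sub_distrib, map_ofNat]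
    ring
  simp only [sysT, sysM, hj0] at h1
  rw [e, map_add, map_add, map_C_mul, map_C_mul]
  have := mul_nonneg (sub_nonneg.2 hx0) h2
  linarith

theorem pseudoExpect_mul_resid (hsat : PDSatisfies μ L (sysT y A g cbar α) 0) {x0 : Fin dx → ℝ}
    {i : Fin n} (hi : ∑ j, (y i j - ∑ k, A i k j * x0 k) ^ 2 ≤ cbar ^ 2) (hh : IsSumSq h)
    (hd : h.totalDegree + 4 ≤ L) :
    0 ≤ pseudoExpect μ (h * (C ((2 * cbar) ^ 2) -
      X (Sum.inl i) * aeval (errPoly n x0) (normAPoly A i))) := by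
  set ω : MvPolynomial (Fin n ⊕ Fin dx) ℝ := X (Sum.inl i) with hω
  have hω1 : ω.totalDegree ≤ 1 := (totalDegree_X (R := ℝ) _).le
  set ρ : Fin dy → MvPolynomial (Fin n ⊕ Fin dx) ℝ := fun j =>
    C (y i j) - ∑ k, C (A i k j) * X (Sum.inr k) with hρ
  have hρ1 : ∀ j, (ρ j).totalDegree ≤ 1 := fun j => totalDegree_sub_le (totalDegree_C_le _ _)
      (totalDegree_finsetSum_le fun _ _ => totalDegree_C_mul_le _ (totalDegree_X (R := ℝ) _).le)
  set ρ0 : Fin dy → ℝ := fun j => y i j - ∑ k, A i k j * x0 k with hρ0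
  set P : MvPolynomial (Fin n ⊕ Fin dx) ℝ := ∑ j, (ρ j + C (ρ0 j)) ^ 2 with hP
  have hP2 : P.totalDegree ≤ 2 := totalDegree_finsetSum_le fun j _ =>
    totalDegree_pow_le (totalDegree_add_le (hρ1 j) (by simp)) 2
  have hPs : IsSumSq P := IsSumSq.sum_sq _ _
  have hU : aeval (errPoly n x0) (normAPoly A i) =
      C 2 * residPoly y A i + C (2 * ∑ j, ρ0 j ^ 2) - P := by
    have : ∀ j, (∑ k, C (A i k j) * errPoly n x0 k) = C (ρ0 j) - ρ j := fun j => by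
      simp only [errPoly, hρ0, hρ, mul_sub, Finset.sum_sub_distrib, map_sub, map_sum, map_mul]
      ring
    have hR : residPoly y A i = ∑ j, ρ j ^ 2 := rfl
    simp only [normAPoly, map_sum, map_pow, map_mul, aeval_X, aeval_C, algebraMap_eq, this, hP, hR,
      sub_sq, add_sq, Finset.sum_add_distrib, Finset.sum_sub_distrib, map_ofNat]
    simp only [mul_assoc, ← Finset.mul_sum, mul_comm (C (ρ0 _))]
    ring
  have h1 := hsat.pseudoExpect_mul_nonneg (d := 3) hh
    (Sum.inr (Sum.inr (Sum.inr (Sum.inl i))))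
    (by
      simp only [sysT, sysM]
      exact totalDegree_sub_le (totalDegree_C_le _ _)
        (totalDegree_mul_le hω1 (totalDegree_residPoly_le y A i))) (by omega)
  simp only [sysT, sysM, ← hω] at h1
  have h2 := hsat.pseudoExpect_nonneg hh (by omega)
  have h3 := hsat.pseudoExpect_nonneg (h := h * (1 - ω) ^ 2) (hh.mul (.sq _))
    ((totalDegree_mul_le le_rfl
      (totalDegree_pow_le (totalDegree_sub_le (by simp) hω1) 2)).trans (by omega))
  have h4 := pseudoExpect_mul_idem hsat hh (by omega) i
  have h5 := hsat.pseudoExpect_nonneg (h := h * (ω ^ 2 * P)) (hh.mul (.mul (.sq _) hPs))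
    ((totalDegree_mul_le le_rfl
      (totalDegree_mul_le (totalDegree_pow_le hω1 2) hP2)).trans (by omega))
  have h6 := pseudoExpect_mul_idem hsat (hh.mul hPs) (by
    have := totalDegree_mul_le le_rfl hP2 (p := h)
    omega) i
  rw [← hω] at h4 h6
  have e : h * (C ((2 * cbar) ^ 2) - ω * aeval (errPoly n x0) (normAPoly A i)) =
      C 2 * (h * (C (cbar ^ 2) - ω * residPoly y A i)) +
      C (2 * (cbar ^ 2 - ∑ j, ρ0 j ^ 2)) * h +
      C (2 * ∑ j, ρ0 j ^ 2) * (h * (1 - ω) ^ 2) +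
      C (2 * ∑ j, ρ0 j ^ 2) * (h * (ω - ω ^ 2)) +
      h * (ω ^ 2 * P) + h * P * (ω - ω ^ 2) := by
    rw [hU]
    simp only [map_mul, map_pow, map_sub, map_ofNat]
    ring
  rw [e]
  simp only [map_add, map_C_mul, h4, h6]
  have a1 := mul_nonneg (sub_nonneg.2 hi) h2
  have a2 := mul_nonneg (Finset.sum_nonneg fun j (_ : j ∈ Finset.univ) => sq_nonneg (ρ0 j)) h3
  linarith

end System

end PseudoExpectation

section Substitution

variable {n dx dy : ℕ}

theorem two_le_totalDegree_C_sub_vnormPoly (hdx : 0 < dx) (c : ℝ) :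
    2 ≤ (C c - vnormPoly dx).totalDegree := by
  refine le_trans (Polynomial.le_natDegree_of_ne_zero ?_)
    (natDegree_aeval_line_le le_rfl (Pi.single ⟨0, hdx⟩ 1))
  rw [map_sub, aeval_line_vnormPoly, aeval_C, Polynomial.algebraMap_eq, Polynomial.coeff_sub,
    Polynomial.coeff_C_mul_X_pow, Polynomial.coeff_C]
  simp [Pi.single_apply]

/-- Sum-of-squares proofs from the ball constraint transfer to functionals by substitution. -/
theorem SosProof.linearMap_aeval_nonneg {V : Type*} (hdx : 0 < dx) {c : ℝ} {k L : ℕ} (hkL : k ≤ L)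
    {G : MvPolynomial (Fin dx) ℝ} (h : SosProof (fun _ : Fin 1 => C c - vnormPoly dx) k G)
    {E : MvPolynomial V ℝ →ₗ[ℝ] ℝ} {σ : Fin dx → MvPolynomial V ℝ}
    (hσ : ∀ k, (σ k).totalDegree ≤ 1)
    (hsos : ∀ h, IsSumSq h → h.totalDegree ≤ L → 0 ≤ E h)
    (hball : ∀ h, IsSumSq h → h.totalDegree + 2 ≤ L →
      0 ≤ E (h * (C c - aeval σ (vnormPoly dx)))) :
    0 ≤ E (aeval σ G) := by
  obtain ⟨P, hP, rfl, hd⟩ := h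
  rw [map_sum, map_sum]
  refine Finset.sum_nonneg fun S _ => ?_
  have hS := hd S
  have hPS : IsSumSq (aeval σ (P S)) :=
    (isSOS_iff_isSumSq.1 (hP S)).map (aeval σ : MvPolynomial (Fin dx) ℝ →ₐ[ℝ] _).toRingHom
  have hdeg := totalDegree_aeval_le σ hσ (P S)
  rw [Finset.prod_const] at hS ⊢
  have hcard : S.card ≤ 1 := S.card_le_univ.trans (by simp)
  obtain h0 | h1 : S.card = 0 ∨ S.card = 1 := by omega
  · rw [h0, pow_zero, mul_one] at hS ⊢
    exact hsos _ hPS (by omega)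
  · rw [h1, pow_one] at hS ⊢
    by_cases hz : P S = 0
    · simp [hz]
    have h2 := two_le_totalDegree_C_sub_vnormPoly hdx c
    have hne : C c - vnormPoly dx ≠ 0 := fun h => by simp [h] at h2
    rw [totalDegree_mul_of_isDomain hz hne] at hS
    have := hball _ hPS (by omega)
    simpa [algebraMap_eq] using this

/-- The anti-concentration upper bound under a functional, with the error scaled by `s`. -/
theorem SosProof.linearMap_antiConcentration_le {V : Type*} (hdx : 0 < dx)
    {A : Fin n → Matrix (Fin dx) (Fin dy) ℝ} {I : Finset (Fin n)} {k L : ℕ} (hkL : k ≤ L)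
    {M b : ℝ} {q : Polynomial ℝ}
    (h : SosProof (fun _ : Fin 1 => C (M ^ 2) - vnormPoly dx) k
      (C b - vnormPoly dx *
        (C ((I.card : ℝ)⁻¹) * ∑ i ∈ I, Polynomial.aeval (normAPoly A i) q ^ 2)))
    {E : MvPolynomial V ℝ →ₗ[ℝ] ℝ} {σ : Fin dx → MvPolynomial V ℝ}
    (hσ : ∀ k, (σ k).totalDegree ≤ 1) (hE : E 1 = 1)
    (hsos : ∀ h, IsSumSq h → h.totalDegree ≤ L → 0 ≤ E h)
    (hball : ∀ h, IsSumSq h → h.totalDegree + 2 ≤ L →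
      0 ≤ E (h * (C (M ^ 2) - aeval σ (vnormPoly dx)))) {s : ℝ} (hs : s ^ 2 ≤ 1) :
    s ^ 2 * ((I.card : ℝ)⁻¹ * ∑ i ∈ I, E (aeval σ (vnormPoly dx) *
      Polynomial.aeval (C (s ^ 2) * aeval σ (normAPoly A i)) q ^ 2)) ≤ b := by
  have key := h.linearMap_aeval_nonneg hdx hkL (E := E) (σ := fun k => C s * σ k)
    (fun k => totalDegree_C_mul_le s (hσ k)) hsos (fun p hp hd => by
      have h1 := hball p hp hd
      have h2 := hsos p hp (by omega)
      have e : p * (C (M ^ 2) - aeval (fun k => C s * σ k) (vnormPoly dx)) =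
          C (s ^ 2) * (p * (C (M ^ 2) - aeval σ (vnormPoly dx))) +
          C ((1 - s ^ 2) * M ^ 2) * p := by
        rw [aeval_C_mul_vnormPoly]
        simp only [map_mul, map_sub, map_one]
        ring
      rw [e, map_add, map_C_mul, map_C_mul]
      exact add_nonneg (mul_nonneg (sq_nonneg s) h1)
        (mul_nonneg (mul_nonneg (sub_nonneg.2 hs) (sq_nonneg M)) h2))
  have e : aeval (fun k => C s * σ k) (C b - vnormPoly dx *
        (C ((I.card : ℝ)⁻¹) * ∑ i ∈ I, Polynomial.aeval (normAPoly A i) q ^ 2)) =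
      C b * 1 - C (s ^ 2) * (C ((I.card : ℝ)⁻¹) * ∑ i ∈ I, aeval σ (vnormPoly dx) *
        Polynomial.aeval (C (s ^ 2) * aeval σ (normAPoly A i)) q ^ 2) := by
    simp only [map_sub, map_mul, aeval_C, algebraMap_eq, aeval_C_mul_vnormPoly, map_sum, map_pow,
      ← Polynomial.aeval_algHom_apply, aeval_C_mul_normAPoly, ← Finset.mul_sum]
    ring
  rw [e, map_sub, map_C_mul, map_C_mul, map_C_mul, hE, map_sum] at key
  linarith

end Substitution

section Estimate

variable {n dx dy mX : ℕ} {y : Fin n → Fin dy → ℝ} {A : Fin n → Matrix (Fin dx) (Fin dy) ℝ}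
  {g : Fin mX → MvPolynomial (Fin dx) ℝ} {cbar α : ℝ} {μ : (Fin n ⊕ Fin dx → ℝ) →₀ ℝ} {L : ℕ}

/-- Under the system `T_{ω,x}` the estimator is the pseudo-expectation of `x`. -/
theorem xhat_eq_pseudoExpect (hα : α * n ≠ 0) (hL : 2 ≤ L) (hE : pseudoExpect μ 1 = 1)
    (hsat : PDSatisfies μ L (sysT y A g cbar α) 0) (k : Fin dx) :
    xhat μ k = pseudoExpect μ (X (Sum.inr k)) := by
  have hEω : ∀ i, Eω μ i = pseudoExpect μ (X (Sum.inl i)) := fun i => by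
    simp [Eω, pseudoExpect_apply]
  have hEωx : ∀ i, (pExpect μ fun z => z (Sum.inl i) * z (Sum.inr k)) =
      pseudoExpect μ (X (Sum.inl i) * X (Sum.inr k)) := fun i => by simp [pseudoExpect_apply]
  have hsq : ∀ p : MvPolynomial (Fin n ⊕ Fin dx) ℝ, p.totalDegree ≤ 1 →
      0 ≤ pseudoExpect μ (p ^ 2) := fun p hp =>
    hsat.pseudoExpect_nonneg (.sq p) ((totalDegree_pow_le hp 2).trans hL)
  have hsum : ∑ i, Eω μ i = α * n := by
    have := pseudoExpect_mul_sum hsat IsSumSq.one (by simp; omega)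
    rw [one_mul, map_sub, ← mul_one (C (α * n)), map_C_mul, hE, map_sum] at this
    simp only [hEω]
    linarith
  have hterm : ∀ i, Eω μ i * vEst μ i k = pseudoExpect μ (X (Sum.inl i) * X (Sum.inr k)) := by
    intro i
    rw [vEst]
    split_ifs with h
    · rw [← hEωx]
      exact mul_inv_cancel_left₀ h.ne' _
    · have h1 := hsq (X (Sum.inl i)) (totalDegree_X _).le
      have h2 := pseudoExpect_mul_idem hsat IsSumSq.one (by simp; omega) i
      rw [one_mul, map_sub, ← hEω] at h2
      have h3 := map_mul_sq_le (E := pseudoExpect μ) hsq (a := X (Sum.inl i))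
        (b := X (Sum.inr k)) (totalDegree_X _).le (totalDegree_X _).le
      have h4 : pseudoExpect μ (X (Sum.inl i) ^ 2) = 0 := by linarith
      rw [h4, zero_mul] at h3
      rw [Pi.zero_apply, mul_zero, pow_eq_zero_iff two_ne_zero |>.1 (le_antisymm h3 (sq_nonneg _))]
  have hzero : pseudoExpect μ ((C (α * n) - ∑ i, X (Sum.inl i)) * X (Sum.inr k)) = 0 := by
    have h3 := map_mul_sq_le (E := pseudoExpect μ) hsq
      (a := C (α * n) - ∑ i, X (Sum.inl i)) (b := X (Sum.inr k))
      (totalDegree_sub_le (totalDegree_C_le _ _) totalDegree_sum_inl_le) (totalDegree_X _).le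
    rw [pseudoExpect_sum_sq hsat hL, zero_mul] at h3
    exact pow_eq_zero_iff two_ne_zero |>.1 (le_antisymm h3 (sq_nonneg _))
  rw [sub_mul, Finset.sum_mul, map_sub, map_sum, map_C_mul] at hzero
  simp only [xhat, hsum, div_mul_eq_mul_div, hterm, ← Finset.sum_div]
  rw [div_eq_iff hα]
  linarith

theorem sum_xhat_sub_sq_le (hα : α * n ≠ 0) (hL : 2 ≤ L) (hE : pseudoExpect μ 1 = 1)
    (hsat : PDSatisfies μ L (sysT y A g cbar α) 0) (x0 : Fin dx → ℝ) :
    ∑ k, (xhat μ - x0) k ^ 2 ≤ pseudoExpect μ (aeval (errPoly n x0) (vnormPoly dx)) := by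
  simp only [vnormPoly, map_sum, map_pow, aeval_X]
  refine Finset.sum_le_sum fun k _ => ?_
  have h := map_mul_sq_le (E := pseudoExpect μ) (d := 1) (a := errPoly n x0 k) (b := 1)
    (fun p hp => hsat.pseudoExpect_nonneg (.sq p) ((totalDegree_pow_le hp 2).trans hL))
    (totalDegree_errPoly_le x0 k) (by simp)
  rw [mul_one, one_pow, hE, mul_one, errPoly, map_sub, ← mul_one (C (x0 k)), map_C_mul, hE,
    mul_one, mul_one, ← xhat_eq_pseudoExpect hα hL hE hsat] at h
  exact h

/-- The average over the inliers of the error weighted by `ω_i`. -/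
theorem le_sum_pseudoExpect_mul (hL : 4 ≤ L) (hsat : PDSatisfies μ L (sysT y A g cbar α) 0)
    {W : MvPolynomial (Fin n ⊕ Fin dx) ℝ} (hW : W.totalDegree ≤ 2) (hWs : IsSumSq W)
    {I : Finset (Fin n)} (hI : (I.card : ℝ) = α * n) :
    (α * n - (n - α * n)) * pseudoExpect μ W ≤
      ∑ i ∈ I, pseudoExpect μ (X (Sum.inl i) * W) := by
  have hsum : ∑ i, pseudoExpect μ (X (Sum.inl i) * W) = α * n * pseudoExpect μ W := by
    have := pseudoExpect_mul_sum hsat hWs (by omega)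
    rw [mul_comm, sub_mul, Finset.sum_mul, map_sub, map_sum, map_C_mul] at this
    linarith
  have hle : ∀ i, pseudoExpect μ (X (Sum.inl i) * W) ≤ pseudoExpect μ W := by
    intro i
    have h1 := hsat.pseudoExpect_nonneg (h := W * (1 - X (Sum.inl i)) ^ 2) (hWs.mul (.sq _))
      ((totalDegree_mul_le hW (totalDegree_pow_le
        (totalDegree_sub_le (by simp) (totalDegree_X (R := ℝ) _).le) 2)).trans hL)
    have h2 := pseudoExpect_mul_idem hsat hWs (by omega) i
    have e : W = X (Sum.inl i) * W + W * (1 - X (Sum.inl i)) ^ 2 +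
        W * (X (Sum.inl i) - X (Sum.inl i) ^ 2) := by ring
    have h3 := congrArg (pseudoExpect μ) e
    rw [map_add, map_add, h2] at h3
    linarith
  have hc : ∑ i ∈ Iᶜ, pseudoExpect μ (X (Sum.inl i) * W) ≤ (n - α * n) * pseudoExpect μ W := by
    refine (Finset.sum_le_card_nsmul _ _ _ fun i _ => hle i).trans ?_
    rw [nsmul_eq_mul, Finset.card_compl, Nat.cast_sub I.card_le_univ, hI, Fintype.card_fin]
  rw [← Finset.sum_add_sum_compl I] at hsum
  linarith

end Estimate

section Core

variable {n dx dy mX : ℕ} {y : Fin n → Fin dy → ℝ} {A : Fin n → Matrix (Fin dx) (Fin dy) ℝ}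
  {g : Fin mX → MvPolynomial (Fin dx) ℝ} {cbar α : ℝ} {μ : (Fin n ⊕ Fin dx → ℝ) →₀ ℝ} {L : ℕ}

/-- Bound on the squared error when the anti-concentration polynomial is not trivial. -/
theorem sq_mul_pseudoExpect_le (hdx : 0 < dx) (hcbar : 0 < cbar)
    (hE : pseudoExpect μ 1 = 1) (hsat : PDSatisfies μ L (sysT y A g cbar α) 0)
    {Mx : ℝ} {j0 : Fin mX} (hj0 : g j0 = C (Mx ^ 2) - vnormPoly dx) {x0 : Fin dx → ℝ}
    (hx0 : ∑ k, x0 k ^ 2 ≤ Mx ^ 2) {I : Finset (Fin n)} (hIcard : (I.card : ℝ) = α * n)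
    (hinlier : ∀ i ∈ I, ∑ j, (y i j - ∑ k, A i k j * x0 k) ^ 2 ≤ cbar ^ 2)
    {k : ℕ} (hkL : k ≤ L) {q : Polynomial ℝ} (hq0 : q.eval 0 = 1) {κ b : ℝ} (hκ : 0 < κ)
    (hlow : ∀ i ∈ I, SosProof (fun _ : Fin 1 => C ((2 * cbar) ^ 2) - normAPoly A i) k
      (Polynomial.aeval (normAPoly A i) q ^ 2 - C (κ ^ 2)))
    (hup : SosProof (fun _ : Fin 1 => C ((2 * Mx) ^ 2) - vnormPoly dx) k
      (C b - vnormPoly dx *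
        (C ((I.card : ℝ)⁻¹) * ∑ i ∈ I, Polynomial.aeval (normAPoly A i) q ^ 2)))
    {i₀ : Fin n} (hi₀ : i₀ ∈ I) {v : Fin dx → ℝ}
    (hv : q.eval (eval v (normAPoly A i₀)) ^ 2 < 1)
    {θ : ℝ} (hθ0 : 0 ≤ θ) (hθ1 : θ ≤ 1) (hθ : θ * (α * n) ≤ α * n - (n - α * n)) :
    θ ^ 2 * κ ^ 2 * pseudoExpect μ (aeval (errPoly n x0) (vnormPoly dx)) ≤ b := by
  set W := aeval (errPoly n x0) (vnormPoly dx) with hWdef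
  set D := pseudoExpect μ W with hD
  set u := eval v (normAPoly A i₀) with hu
  have hu0 : 0 < u := by
    have : 0 ≤ u := ((isSumSq_normAPoly A i₀).map (eval v)).nonneg
    refine this.lt_of_ne' fun h => ?_
    rw [h, hq0] at hv
    norm_num at hv
  have hqne : q ≠ 0 := by rintro rfl; simp at hq0
  have hdegk := hup.natDegree_le hqne hi₀ hu0
  have hmin := le_eval_of_sosProof (hlow i₀ hi₀) hκ hq0 hu0
  have hWd : W.totalDegree ≤ 2 :=
    (totalDegree_aeval_le _ (totalDegree_errPoly_le x0) _).trans totalDegree_vnormPoly_le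
  have hWs : IsSumSq W := isSumSq_vnormPoly.map (aeval (errPoly n x0)).toRingHom
  have hUd : ∀ i, (aeval (errPoly n x0) (normAPoly A i)).totalDegree ≤ 2 := fun i =>
    (totalDegree_aeval_le _ (totalDegree_errPoly_le x0) _).trans (totalDegree_normAPoly_le A i)
  have hUs : ∀ i, IsSumSq (aeval (errPoly n x0) (normAPoly A i)) := fun i =>
    (isSumSq_normAPoly A i).map (aeval (errPoly n x0)).toRingHom
  have hsos : ∀ h, IsSumSq h → h.totalDegree ≤ L → 0 ≤ pseudoExpect μ h := fun h hh hd =>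
    hsat.pseudoExpect_nonneg hh hd
  have hupper : ∀ {s : ℝ}, s ^ 2 ≤ 1 → s ^ 2 * ((I.card : ℝ)⁻¹ * ∑ i ∈ I, pseudoExpect μ (W *
      Polynomial.aeval (C (s ^ 2) * aeval (errPoly n x0) (normAPoly A i)) q ^ 2)) ≤ b :=
    fun hs => hup.linearMap_antiConcentration_le hdx hkL (totalDegree_errPoly_le x0) hE hsos
      (fun h hh hd => pseudoExpect_mul_ball hsat hj0 hx0 hh hd) hs
  have hcard : (0 : ℝ) < I.card := Nat.cast_pos.2 (Finset.card_pos.2 ⟨i₀, hi₀⟩)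
  have hm : q.natDegree ≠ 0 := by
    intro h
    rw [Polynomial.eq_C_of_natDegree_eq_zero h] at hq0 hv
    rw [Polynomial.eval_C] at hq0 hv
    rw [hq0] at hv
    norm_num at hv
  have hD0 : 0 ≤ D := hsos W hWs (by omega)
  set a := (I.card : ℝ)⁻¹ * ∑ i ∈ I, pseudoExpect μ (X (Sum.inl i) * W) with ha
  have hDa : θ * D ≤ a := by
    have := le_sum_pseudoExpect_mul (by omega) hsat hWd hWs hIcard
    rw [ha, inv_mul_eq_div, le_div_iff₀ hcard, hIcard]
    nlinarith
  obtain h1 | h2 : q.natDegree = 1 ∨ 2 ≤ q.natDegree := by omega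
  · obtain ⟨c, hc⟩ : ∃ c : ℝ, q = 1 - Polynomial.C c * Polynomial.X := by
      refine ⟨-q.coeff 1, ?_⟩
      have h := Polynomial.eq_X_add_C_of_natDegree_le_one h1.le
      have h0 : q.coeff 0 = 1 := by rw [Polynomial.coeff_zero_eq_eval_zero, hq0]
      rw [h0] at h
      rw [map_neg, neg_mul, sub_neg_eq_add, add_comm, ← Polynomial.C_1]
      exact h
    have hqe : ∀ x, q.eval x = 1 - c * x := fun x => by simp [hc]
    have hc0 : 0 ≤ c := by
      by_contra! h
      rw [hqe] at hv
      nlinarith [mul_pos (neg_pos.2 h) hu0]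
    have hz : κ ≤ 1 - c * (2 * cbar) ^ 2 := by
      rw [← hqe]
      exact hmin _ ⟨sq_nonneg _, le_rfl⟩
    set z := c * (2 * cbar) ^ 2 with hzdef
    have hlower : ∀ i ∈ I, (2 * (1 - z) - (1 - z) ^ 2) * pseudoExpect μ (X (Sum.inl i) * W) -
        2 * (1 - z) * θ * z * D ≤ pseudoExpect μ (W *
        Polynomial.aeval (C (√θ ^ 2) * aeval (errPoly n x0) (normAPoly A i)) q ^ 2) := by
      intro i hi
      have := le_map_mul_one_sub_sq (E := pseudoExpect μ) (L := L) (ω := X (Sum.inl i))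
        (by omega) (totalDegree_X _).le (hUd i) hWd hWs hsos
        (fun h hh hd => pseudoExpect_mul_idem hsat hh hd i)
        (fun h hh hd => pseudoExpect_mul_resid hsat (hinlier i hi) hh hd)
        (c := c * θ) (t := 1 - z) (mul_nonneg hc0 hθ0) (by linarith)
      have e : Polynomial.aeval (C (√θ ^ 2) * aeval (errPoly n x0) (normAPoly A i)) q =
          1 - C (c * θ) * aeval (errPoly n x0) (normAPoly A i) := by
        rw [Real.sq_sqrt hθ0, hc]
        simp only [map_sub, map_one, map_mul, Polynomial.aeval_C, Polynomial.aeval_X, algebraMap_eq]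
        ring
      rw [e]
      refine le_trans (le_of_eq ?_) this
      rw [hzdef]
      ring
    have hsum := Finset.sum_le_sum hlower
    rw [Finset.sum_sub_distrib, ← Finset.mul_sum, Finset.sum_const, nsmul_eq_mul] at hsum
    have hsum' := mul_le_mul_of_nonneg_left hsum (inv_nonneg.2 hcard.le)
    have hs := hupper (s := √θ) (by rwa [Real.sq_sqrt hθ0])
    have e : (I.card : ℝ)⁻¹ * ((2 * (1 - z) - (1 - z) ^ 2) *
        ∑ i ∈ I, pseudoExpect μ (X (Sum.inl i) * W) - I.card * (2 * (1 - z) * θ * z * D)) =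
        (2 * (1 - z) - (1 - z) ^ 2) * a - 2 * (1 - z) * θ * z * D := by
      rw [ha, mul_sub, inv_mul_cancel_left₀ hcard.ne']
      ring
    rw [e] at hsum'
    have hs' := (mul_le_mul_of_nonneg_left hsum' (sq_nonneg √θ)).trans hs
    rw [Real.sq_sqrt hθ0] at hs'
    refine le_trans ?_ hs'
    have hz0 : 0 ≤ z := mul_nonneg hc0 (sq_nonneg _)
    have ht : 0 ≤ 2 * (1 - z) - (1 - z) ^ 2 := by nlinarith
    calc θ ^ 2 * κ ^ 2 * D ≤ θ ^ 2 * (1 - z) ^ 2 * D := by gcongr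
      _ = θ * ((2 * (1 - z) - (1 - z) ^ 2) * (θ * D) - 2 * (1 - z) * θ * z * D) := by ring
      _ ≤ _ := by gcongr
  · have hlower : ∀ i ∈ I, κ ^ 2 * pseudoExpect μ (X (Sum.inl i) * W) ≤ pseudoExpect μ (W *
        Polynomial.aeval (C (1 ^ 2) * aeval (errPoly n x0) (normAPoly A i)) q ^ 2) := by
      intro i hi
      rw [one_pow, C_1, one_mul]
      exact le_map_mul_aeval_sq (totalDegree_X _).le (hUd i) (hUs i) hWd hWs hsos
        (fun h hh hd => pseudoExpect_mul_idem hsat hh hd i)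
        (fun h hh hd => pseudoExpect_mul_resid hsat (hinlier i hi) hh hd)
        (by positivity) h2 (by omega) hκ.le hmin
    have hsum := mul_le_mul_of_nonneg_left (Finset.sum_le_sum hlower) (inv_nonneg.2 hcard.le)
    have hs := hupper (s := 1) (by norm_num)
    rw [← Finset.mul_sum, mul_left_comm, ← ha] at hsum
    calc θ ^ 2 * κ ^ 2 * D = θ * (κ ^ 2 * (θ * D)) := by ring
      _ ≤ 1 * (κ ^ 2 * (θ * D)) := by gcongr
      _ ≤ κ ^ 2 * a := by rw [one_mul]; gcongr
      _ ≤ _ := hsum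
      _ ≤ b := by simpa using hs

/-- The anti-concentration upper bound cannot vanish. -/
theorem SosProof.antiConcentration_ne_zero (hdx : 0 < dx) {I : Finset (Fin n)} (hI : I.Nonempty) {M : ℝ}
    (hM : 0 < M) {k : ℕ} {q : Polynomial ℝ} (hq0 : q.eval 0 = 1) {b : ℝ}
    (hup : SosProof (fun _ : Fin 1 => C (M ^ 2) - vnormPoly dx) k
      (C b - vnormPoly dx *
        (C ((I.card : ℝ)⁻¹) * ∑ i ∈ I, Polynomial.aeval (normAPoly A i) q ^ 2))) : b ≠ 0 := by
  rintro rfl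
  obtain ⟨i, hi⟩ := hI
  have hcard : (0 : ℝ) < I.card := Nat.cast_pos.2 (Finset.card_pos.2 ⟨i, hi⟩)
  set e : Fin dx → ℝ := Pi.single ⟨0, hdx⟩ 1 with he
  have hes : ∑ j, e j ^ 2 = 1 := by simp [he, Pi.single_apply]
  have hroot : ∀ t ∈ Set.Ioc 0 M, q.eval (t ^ 2 * eval e (normAPoly A i)) = 0 := by
    intro t ht
    have hte : ∑ j, (t • e) j ^ 2 = t ^ 2 := by
      simp only [Pi.smul_apply, smul_eq_mul, mul_pow, ← Finset.mul_sum, hes, mul_one]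
    have h := hup.antiConcentration_le (v := t • e) (by
      rw [hte]
      exact pow_le_pow_left₀ ht.1.le ht.2 2)
    rw [hte] at h
    by_contra hne
    refine h.not_gt (mul_pos (pow_pos ht.1 2) (mul_pos (inv_pos.2 hcard)
      (Finset.sum_pos' (fun _ _ => sq_nonneg _) ⟨i, hi, ?_⟩)))
    rw [eval_normAPoly_smul]
    exact sq_pos_of_ne_zero hne
  have hcont : Continuous fun t : ℝ => q.eval (t ^ 2 * eval e (normAPoly A i)) :=
    q.continuous.comp (by fun_prop)
  have hlim := hcont.continuousWithinAt (s := Set.Ioi 0) (x := 0)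
  have : Filter.Tendsto (fun t : ℝ => q.eval (t ^ 2 * eval e (normAPoly A i)))
      (nhdsWithin 0 (Set.Ioi 0)) (nhds 0) := by
    refine tendsto_const_nhds.congr' ?_
    filter_upwards [Ioc_mem_nhdsGT hM] with t ht using (hroot t ht).symm
  have h01 := tendsto_nhds_unique hlim this
  simp [hq0] at h01

end Core

/-- A priori estimation contract for the moment relaxation of (LTS2): under
certifiable anti-concentration of the inliers, any level-`2r` pseudo-distribution
(`r ≥ k/2`) satisfying `T_{ω,x}` at degree `0` yields an estimate `x̂` with
`‖x̂ − x°‖ ≤ α·η·M_x/2 + 2·M_x·(1−α)/α`. -/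
theorem lts_a_priori_contract
    {n dx dy mX : ℕ} (hn : 0 < n) (hdx : 0 < dx) (hdy : 0 < dy)
    (y : Fin n → Fin dy → ℝ) (A : Fin n → Matrix (Fin dx) (Fin dy) ℝ)
    (g : Fin mX → MvPolynomial (Fin dx) ℝ)
    (Mx : ℝ) (hMx : 0 < Mx)
    (j0 : Fin mX) (hj0 : g j0 = C (Mx ^ 2) - vnormPoly dx)
    (x0 : Fin dx → ℝ) (hx0 : ∀ j, 0 ≤ MvPolynomial.eval x0 (g j))
    (cbar : ℝ) (hcbar : 0 < cbar)
    (α : ℝ) (hα0 : 0 < α) (hα1 : α ≤ 1)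
    (I : Finset (Fin n)) (hIcard : (I.card : ℝ) = α * n)
    (hinlier : ∀ i ∈ I, _root_.enorm (fun j => y i j - ∑ k, A i k j * x0 k) ≤ cbar)
    (η : ℝ) (hη : 0 < η)
    (k : ℕ) (hk : 0 < k) (hke : Even k)
    (hAC : AntiConcentrated A I k
      (α ^ 2 * η ^ 2 * (1 - 2 * cbar) ^ 2 / (32 * cbar)) (2 * cbar) (2 * Mx))
    (r : ℕ) (hr : k / 2 ≤ r)
    (μ : (Fin n ⊕ Fin dx → ℝ) →₀ ℝ)
    (hpd : IsPseudoDist μ (2 * r))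
    (hsat : PDSatisfies μ (2 * r) (sysT y A g cbar α) 0) :
    _root_.enorm (xhat μ - x0) ≤ α * η * Mx / 2 + 2 * Mx * (1 - α) / α := by
  obtain ⟨p, q, hpq, hp0, hlow, hup⟩ := hAC
  have hn' : (0 : ℝ) < n := Nat.cast_pos.2 hn
  have hcard : (0 : ℝ) < I.card := by rw [hIcard]; positivity
  have hI : I.Nonempty := Finset.card_pos.1 (Nat.cast_pos.1 hcard)
  have hq0 : q.eval 0 = 1 := by simpa [hp0] using (hpq 0).symm
  have hL : k ≤ 2 * r := by obtain ⟨m, rfl⟩ := hke; omega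
  have hE := hpd.pseudoExpect_one
  have hx0' : ∑ j, x0 j ^ 2 ≤ Mx ^ 2 := by
    simpa [hj0, eval_vnormPoly] using hx0 j0
  have hin : ∀ i ∈ I, ∑ j, (y i j - ∑ k, A i k j * x0 k) ^ 2 ≤ cbar ^ 2 := fun i hi =>
    (Real.sqrt_le_left hcbar.le).1 (hinlier i hi)
  set κ := |1 - 2 * cbar| with hκdef
  set Eb := α * η * Mx / 2 with hEb
  have hEb0 : 0 < Eb := by positivity
  have hb : α ^ 2 * η ^ 2 * (1 - 2 * cbar) ^ 2 / (32 * cbar) * (2 * cbar) * (2 * Mx) ^ 2 =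
      κ ^ 2 * Eb ^ 2 := by
    rw [hκdef, sq_abs, hEb]
    field_simp
    ring
  rw [hb] at hup
  rw [← sq_abs (1 - 2 * cbar)] at hlow
  have hκ : 0 < κ := (abs_nonneg _).lt_of_ne' fun h =>
    hup.antiConcentration_ne_zero hdx hI (by positivity) hq0 (by rw [hκdef, h]; ring)
  have hκ1 : κ ^ 2 ≤ 1 := by
    obtain ⟨i, hi⟩ := hI
    have h0 : eval 0 (normAPoly A i) = 0 := by rw [eval_normAPoly]; simp
    have := (hlow i hi).eval_nonneg (v := 0) fun _ => by
      rw [map_sub, eval_C, h0, sub_zero]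
      exact sq_nonneg _
    rw [map_sub, map_pow, eval_polynomial_aeval, h0, hq0, eval_C, one_pow] at this
    linarith
  set D := pseudoExpect μ (aeval (errPoly n x0) (vnormPoly dx)) with hD
  have hdD : _root_.enorm (xhat μ - x0) ^ 2 ≤ D := by
    rw [_root_.enorm, Real.sq_sqrt (Finset.sum_nonneg fun _ _ => sq_nonneg _)]
    exact sum_xhat_sub_sq_le (by positivity) (by omega) hE hsat x0
  have hd0 : 0 ≤ _root_.enorm (xhat μ - x0) := Real.sqrt_nonneg _
  have hDM : D ≤ (2 * Mx) ^ 2 := by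
    have := pseudoExpect_mul_ball hsat hj0 hx0' IsSumSq.one (by simp; omega)
    rw [one_mul, map_sub, ← mul_one (C ((2 * Mx) ^ 2)), map_C_mul, hE] at this
    linarith
  set d := _root_.enorm (xhat μ - x0) with hd
  have hdM : d ≤ 2 * Mx := le_of_sq_le_sq (hdD.trans hDM) (by positivity)
  have hγ0 : 0 ≤ 2 * Mx * (1 - α) / α := by
    have := sub_nonneg.2 hα1
    positivity
  by_cases htriv : ∀ i ∈ I,
      1 ≤ q.eval (eval (Pi.single ⟨0, hdx⟩ (2 * Mx)) (normAPoly A i)) ^ 2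
  · have hes : ∑ j, (Pi.single ⟨0, hdx⟩ (2 * Mx) : Fin dx → ℝ) j ^ 2 = (2 * Mx) ^ 2 := by
      simp [Pi.single_apply, ite_pow]
    have h := hup.antiConcentration_le hes.le
    rw [hes] at h
    have h1 : (1 : ℝ) ≤ (I.card : ℝ)⁻¹ *
        ∑ i ∈ I, q.eval (eval (Pi.single ⟨0, hdx⟩ (2 * Mx)) (normAPoly A i)) ^ 2 := by
      rw [inv_mul_eq_div, le_div_iff₀ hcard, one_mul]
      simpa using Finset.card_nsmul_le_sum I _ 1 htriv
    have h2 : (2 * Mx) ^ 2 ≤ Eb ^ 2 :=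
      calc (2 * Mx) ^ 2 ≤ _ := le_mul_of_one_le_right (sq_nonneg _) h1
        _ ≤ κ ^ 2 * Eb ^ 2 := h
        _ ≤ Eb ^ 2 := mul_le_of_le_one_left (sq_nonneg _) hκ1
    have h3 : 2 * Mx ≤ Eb := le_of_sq_le_sq h2 hEb0.le
    linarith
  · push Not at htriv
    obtain ⟨i, hi, hv⟩ := htriv
    set θ := 1 - (1 - α) / α with hθ
    have hγ : 0 ≤ (1 - α) / α := div_nonneg (sub_nonneg.2 hα1) hα0.le
    have hγM : 2 * Mx * (1 - α) / α = (1 - θ) * (2 * Mx) := by rw [hθ]; ring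
    have hθ1 : θ ≤ 1 := by linarith
    rw [hγM]
    rcases le_or_gt θ 0 with hneg | hpos
    · nlinarith
    have hθα : θ * (α * n) = α * n - (n - α * n) := by
      rw [hθ]
      field_simp
    have h := sq_mul_pseudoExpect_le hdx hcbar hE hsat hj0 hx0' hIcard hin hL hq0 hκ hlow hup hi hv
      hpos.le hθ1 hθα.le
    have h1 : (θ * d) ^ 2 ≤ Eb ^ 2 := by
      have h2 : θ ^ 2 * D ≤ Eb ^ 2 := by
        refine le_of_mul_le_mul_left (a := κ ^ 2) ?_ (pow_pos hκ 2)
        linarith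
      rw [mul_pow]
      exact (mul_le_mul_of_nonneg_left hdD (sq_nonneg θ)).trans h2
    have h2 : θ * d ≤ Eb := le_of_sq_le_sq h1 hEb0.le
    have h3 := mul_le_mul_of_nonneg_left hdM (sub_nonneg.2 hθ1)
    linarith
end
end
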